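/- arXiv:2307.06113 — 7 statements merged into one kernel-verified Lean document; each statement's English description precedes it below -/
import Mathlib

section
/- Let G be an (n,d,λ)-graph with 0 < λ < d and adjacency matrix A, let s be any vertex, and let k be a positive integer. Then the number of vertices t for which the (s,t) entry of A^k is zero (i.e., there is no walk of length k from s to t) is at most (λ/d)^{2k}·n². -/
/-- `G` is an `(n,d,λ)`-graph: a simple `d`-regular graph on `n` vertices whose adjacency
matrix has all eigenvalues corresponding to eigenvectors orthogonal to the all-ones vector
bounded by `lam` in absolute value. -/
def IsNDLGraph (n d : ℕ) (lam : ℝ) (G : SimpleGraph (Fin n)) [DecidableRel G.Adj] : Prop :=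
  G.IsRegularOfDegree d ∧
    ∀ (μ : ℝ) (v : Fin n → ℝ), v ≠ 0 → Matrix.mulVec (G.adjMatrix ℝ) v = μ • v →
      (∑ i, v i) = 0 → |μ| ≤ lam

theorem aux_row (n d : ℕ) (G : SimpleGraph (Fin n)) [DecidableRel G.Adj]
    (hr : G.IsRegularOfDegree d) (i : Fin n) : ∑ j, G.adjMatrix ℝ i j = d := by
  have := SimpleGraph.adjMatrix_mulVec_const_apply_of_regular (α := ℝ) (a := 1) hr (v := i)
  simpa only [Matrix.mulVec, dotProduct, Function.const_apply, mul_one] using this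

theorem aux_contract {n : ℕ} (B : Matrix (Fin n) (Fin n) ℝ) (hB : B.IsHermitian) (lam : ℝ)
    (h : ∀ (μ : ℝ) (v : Fin n → ℝ), v ≠ 0 → Matrix.mulVec B v = μ • v → |μ| ≤ lam)
    (v : Fin n → ℝ) : ∑ i, (B.mulVec v i) ^ 2 ≤ lam ^ 2 * ∑ i, (v i) ^ 2 := by
  have key : ∀ w : Fin n → ℝ, ∑ i, (w i) ^ 2
      = ∑ j, (inner ℝ (hB.eigenvectorBasis j) (WithLp.toLp 2 w)) ^ 2 := by
    intro w
    have h1 := hB.eigenvectorBasis.sum_sq_norm_inner_right (WithLp.toLp 2 w)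
    rw [EuclideanSpace.norm_sq_eq] at h1
    simpa using h1.symm
  rw [key, key v, Finset.mul_sum]
  refine Finset.sum_le_sum fun j _ => ?_
  have hsym := Matrix.isSymmetric_toEuclideanLin_iff.2 hB
  have e := hB.mulVec_eigenvectorBasis j
  have h2 : inner ℝ (hB.eigenvectorBasis j) (WithLp.toLp 2 (B.mulVec v))
      = hB.eigenvalues j * inner ℝ (hB.eigenvectorBasis j) (WithLp.toLp 2 v) := by
    have h3 := hsym (hB.eigenvectorBasis j) (WithLp.toLp 2 v)
    have h4 : Matrix.toEuclideanLin B (hB.eigenvectorBasis j)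
        = hB.eigenvalues j • hB.eigenvectorBasis j := by
      ext i
      exact congrFun e i
    rw [h4, inner_smul_left] at h3
    exact h3.symm
  rw [h2, mul_pow]
  have hl : |hB.eigenvalues j| ≤ lam := by
    refine h _ _ ?_ e
    intro h0
    apply hB.eigenvectorBasis.orthonormal.ne_zero j
    ext i
    exact congrFun h0 i
  have : hB.eigenvalues j ^ 2 ≤ lam ^ 2 := sq_le_sq' (abs_le.1 hl).1 (abs_le.1 hl).2
  exact mul_le_mul_of_nonneg_right this (sq_nonneg _)

theorem aux_graph (n d : ℕ) (lam : ℝ) (G : SimpleGraph (Fin n)) [DecidableRel G.Adj]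
    (hG : IsNDLGraph n d lam G) (hlam0 : 0 < lam) (v : Fin n → ℝ) (hv : ∑ i, v i = 0) :
    ∑ i, ((G.adjMatrix ℝ).mulVec v i) ^ 2 ≤ lam ^ 2 * ∑ i, (v i) ^ 2 := by
  obtain ⟨hr, hE⟩ := hG
  rcases Nat.eq_zero_or_pos n with rfl | hn
  · simp
  have hn' : (n : ℝ) ≠ 0 := by positivity
  set A := G.adjMatrix ℝ with hA
  let B : Matrix (Fin n) (Fin n) ℝ := A - Matrix.of fun _ _ => (d : ℝ) / n
  have hAs : ∀ i j, A i j = A j i := fun i j => congrFun (congrFun G.isSymm_adjMatrix j) i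
  have hrow : ∀ i, ∑ j, A i j = d := aux_row n d G hr
  have hBv : ∀ w : Fin n → ℝ, ∀ i, B.mulVec w i = A.mulVec w i - d / n * ∑ j, w j := by
    intro w i
    simp [B, Matrix.mulVec, dotProduct, Finset.mul_sum, sub_mul, Finset.sum_sub_distrib]
  have hsum : ∀ w : Fin n → ℝ, ∑ i, A.mulVec w i = d * ∑ j, w j := by
    intro w
    simp only [Matrix.mulVec, dotProduct]
    rw [Finset.sum_comm, Finset.mul_sum]
    refine Finset.sum_congr rfl fun j _ => ?_
    rw [← Finset.sum_mul, ← hrow j]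
    simp only [hAs j]
  have hBh : B.IsHermitian := by
    ext i j
    simp [B, hAs i j]
  have := aux_contract B hBh lam ?_ v
  · simpa [hBv, hv] using this
  intro μ w hw hμ
  by_cases h0 : μ = 0
  · simp [h0, hlam0.le]
  have hs : ∑ i, w i = 0 := by
    have h1 : ∑ i, B.mulVec w i = μ * ∑ i, w i := by
      rw [hμ]; simp [Finset.mul_sum]
    have h2 : ∑ i, B.mulVec w i = 0 := by
      simp only [hBv, Finset.sum_sub_distrib, hsum]
      simp
      field_simp
      simp
    rw [h2] at h1
    simpa [h0] using h1.symm
  refine hE μ w hw ?_ hs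
  rw [← hμ]
  ext i
  simp [hBv, hs]

/-- If `G` is an `(n,d,λ)`-graph with `0 < λ < d`, `s` a vertex and `k` a positive integer,
then the number of vertices `t` with `(A^k)_{s,t} = 0` (no walk of length `k` from `s` to `t`)
is at most `(λ/d)^{2k}·n²`. -/
theorem stmt1 (n d : ℕ) (lam : ℝ) (G : SimpleGraph (Fin n)) [DecidableRel G.Adj]
    (hG : IsNDLGraph n d lam G) (hlam0 : 0 < lam) (hlamd : lam < d)
    (s : Fin n) (k : ℕ) (hk : 0 < k) :
    (Nat.card {t : Fin n // ((G.adjMatrix ℝ) ^ k) s t = 0} : ℝ)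
      ≤ (lam / d) ^ (2 * k) * (n : ℝ) ^ 2 := by
  have hd : (0 : ℝ) < d := hlam0.trans hlamd
  have hn : 0 < n := s.pos
  have hnR : (0 : ℝ) < n := by exact_mod_cast hn
  have hr := hG.1
  set A := G.adjMatrix ℝ with hA
  have hAs : ∀ i j, A i j = A j i := fun i j => congrFun (congrFun G.isSymm_adjMatrix j) i
  have hrow : ∀ i, ∑ j, A i j = d := aux_row n d G hr
  have hpow : ∀ k : ℕ, ∑ t, (A ^ k) s t = (d : ℝ) ^ k := by
    intro k
    induction k with
    | zero => simp [Matrix.one_apply]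
    | succ k ih =>
      simp only [pow_succ, Matrix.mul_apply]
      rw [Finset.sum_comm]
      simp only [← Finset.mul_sum, hrow, ← Finset.sum_mul, ih]
  have hu0 : ∀ k : ℕ, ∑ t, ((A ^ k) s t - (d : ℝ) ^ k / n) = 0 := by
    intro k
    rw [Finset.sum_sub_distrib, hpow]
    simp
    field_simp
    simp
  have main : ∀ k : ℕ, ∑ t, ((A ^ k) s t - (d : ℝ) ^ k / n) ^ 2 ≤ lam ^ (2 * k) := by
    intro k
    induction k with
    | zero =>
      simp only [pow_zero, Matrix.one_apply, sub_sq, Finset.sum_add_distrib,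
        Finset.sum_sub_distrib]
      simp
      field_simp
      linarith
    | succ k ih =>
      have h1 := aux_graph n d lam G hG hlam0 _ (hu0 k)
      have h2 : ∀ t, A.mulVec (fun t => (A ^ k) s t - (d : ℝ) ^ k / n) t
          = (A ^ (k + 1)) s t - (d : ℝ) ^ (k + 1) / n := by
        intro t
        simp only [Matrix.mulVec, dotProduct, pow_succ, Matrix.mul_apply, mul_sub,
          Finset.sum_sub_distrib, ← Finset.sum_mul, hrow]
        congr 1
        · exact Finset.sum_congr rfl fun j _ => by rw [hAs t j, mul_comm]
        · ring
      rw [← hA] at h1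
      simp only [h2] at h1
      refine h1.trans ?_
      rw [show 2 * (k + 1) = 2 + 2 * k by ring, pow_add]
      exact mul_le_mul_of_nonneg_left ih (sq_nonneg _)
  classical
  rw [Nat.card_eq_fintype_card, Fintype.card_subtype]
  have h3 : ((Finset.univ.filter fun t => (A ^ k) s t = 0).card : ℝ) * ((d : ℝ) ^ k / n) ^ 2
      ≤ lam ^ (2 * k) := by
    refine le_trans ?_ (main k)
    rw [← nsmul_eq_mul, ← Finset.sum_const]
    refine le_trans (le_of_eq ?_) (Finset.sum_le_sum_of_subset_of_nonneg
      (Finset.filter_subset (fun t => (A ^ k) s t = 0) _) fun _ _ _ => sq_nonneg _)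
    refine Finset.sum_congr rfl fun t ht => ?_
    rw [(Finset.mem_filter.1 ht).2]
    ring
  have h4 : (0 : ℝ) < ((d : ℝ) ^ k / n) ^ 2 := by positivity
  rw [← le_div_iff₀ h4] at h3
  refine h3.trans (le_of_eq ?_)
  rw [div_pow, div_pow, ← pow_mul, mul_comm k 2]
  field_simp
end

section
/- Let G be an (n,d,λ)-graph with d ≥ 3 and 0 < λ < d, let s be any vertex, and let 0 < δ < 1. Set r = ⌈(1/4)·lg_{d/λ}(n/δ)⌉. Then for at least (1−δ)n vertices t it holds that dist(s,t) ≤ 2r (so the balls B(s,r) and B(t,r) have a common vertex), and each of the balls B(s,r) and B(t,r) contains at most 3(d−1)^r vertices. Consequently bidirectional BFS from s and t finds a shortest s-t path after visiting at most 6(d−1)^r vertices. -/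
/-- The ball of radius `r` around `v`: all vertices at (finite) graph distance at most `r`. -/
def GraphBall {n : ℕ} (G : SimpleGraph (Fin n)) (v : Fin n) (r : ℕ) : Set (Fin n) :=
  {u : Fin n | G.Reachable v u ∧ G.dist v u ≤ r}

lemma ndl_pred {n : ℕ} (G : SimpleGraph (Fin n)) (v u : Fin n) (k : ℕ)
    (h : G.Reachable v u) (hk : G.dist v u = k + 1) :
    ∃ p, G.Adj u p ∧ G.Reachable v p ∧ G.dist v p = k := by
  obtain ⟨w, hw⟩ := h.symm.exists_walk_length_eq_dist
  rw [SimpleGraph.dist_comm, hk] at hw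
  cases w with
  | nil => simp at hw
  | @cons _ p _ hadj q =>
    simp at hw
    refine ⟨p, hadj, q.reachable.symm, ?_⟩
    have h1 : G.dist p v ≤ k := hw ▸ SimpleGraph.dist_le q
    rw [SimpleGraph.dist_comm] at h1
    obtain ⟨w2, hw2⟩ := q.reachable.symm.exists_walk_length_eq_dist
    have h2 := SimpleGraph.dist_le (w2.concat hadj.symm)
    rw [SimpleGraph.Walk.length_concat, hw2, hk] at h2
    omega

open Classical in
noncomputable def ndlSphere {n : ℕ} (G : SimpleGraph (Fin n)) (v : Fin n) (k : ℕ) :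
    Finset (Fin n) := Finset.univ.filter (fun u => G.Reachable v u ∧ G.dist v u = k)

open Classical in
lemma ndl_sphere_card {n d : ℕ} (G : SimpleGraph (Fin n)) [DecidableRel G.Adj]
    (hG : G.IsRegularOfDegree d) (v : Fin n) (k : ℕ) :
    (ndlSphere G v (k+1)).card ≤ d * (d - 1) ^ k := by
  induction k with
  | zero =>
    have : ndlSphere G v 1 ⊆ G.neighborFinset v := by
      intro u hu
      simp only [ndlSphere, Finset.mem_filter, Finset.mem_univ, true_and] at hu
      simpa using SimpleGraph.dist_eq_one_iff_adj.1 hu.2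
    have h := Finset.card_le_card this
    rw [SimpleGraph.card_neighborFinset_eq_degree, hG v] at h
    simpa using h
  | succ k ih =>
    have hsub : ndlSphere G v (k+2) ⊆ (ndlSphere G v (k+1)).biUnion
        (fun p => G.neighborFinset p ∩ ndlSphere G v (k+2)) := by
      intro u hu
      have hu' := hu
      simp only [ndlSphere, Finset.mem_filter, Finset.mem_univ, true_and] at hu'
      obtain ⟨p, h1, h2, h3⟩ := ndl_pred G v u (k+1) hu'.1 hu'.2
      rw [Finset.mem_biUnion]
      refine ⟨p, by simp [ndlSphere, h2, h3], ?_⟩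
      rw [Finset.mem_inter]
      exact ⟨by simpa using h1.symm, hu⟩
    refine (Finset.card_le_card hsub).trans ?_
    refine (Finset.card_biUnion_le_card_mul _ _ (d-1) ?_).trans ?_
    · intro p hp
      simp only [ndlSphere, Finset.mem_filter, Finset.mem_univ, true_and] at hp
      obtain ⟨q, h1, h2, h3⟩ := ndl_pred G v p k hp.1 hp.2
      have : G.neighborFinset p ∩ ndlSphere G v (k+2) ⊆ (G.neighborFinset p).erase q := by
        intro x hx
        rw [Finset.mem_inter] at hx
        rw [Finset.mem_erase]
        refine ⟨?_, hx.1⟩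
        rintro rfl
        have := hx.2
        simp only [ndlSphere, Finset.mem_filter, Finset.mem_univ, true_and] at this
        omega
      refine (Finset.card_le_card this).trans ?_
      rw [Finset.card_erase_of_mem (by simpa using h1),
        SimpleGraph.card_neighborFinset_eq_degree, hG p]
    · calc _ ≤ d * (d-1)^k * (d-1) := Nat.mul_le_mul_right _ ih
        _ = _ := by ring

open Classical in
lemma ndl_ball_aux {n d : ℕ} (hd : 3 ≤ d) (G : SimpleGraph (Fin n)) [DecidableRel G.Adj]
    (hG : G.IsRegularOfDegree d) (v : Fin n) (r : ℕ) :
    (Finset.univ.filter (fun u => G.Reachable v u ∧ G.dist v u ≤ r)).card + 2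
      ≤ 3 * (d - 1) ^ r := by
  induction r with
  | zero =>
    have : (Finset.univ.filter (fun u => G.Reachable v u ∧ G.dist v u ≤ 0)) ⊆ {v} := by
      intro u hu
      simp only [Finset.mem_filter, Finset.mem_univ, true_and] at hu
      have := hu.1.dist_eq_zero_iff.1 (Nat.le_zero.1 hu.2)
      simp [this]
    have := Finset.card_le_card this
    simp at this ⊢
    exact this
  | succ r ih =>
    have hsub : (Finset.univ.filter (fun u => G.Reachable v u ∧ G.dist v u ≤ r + 1)) ⊆
        (Finset.univ.filter (fun u => G.Reachable v u ∧ G.dist v u ≤ r)) ∪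
          ndlSphere G v (r+1) := by
      intro u hu
      simp only [ndlSphere, Finset.mem_union, Finset.mem_filter, Finset.mem_univ, true_and] at hu ⊢
      rcases Nat.lt_or_ge (G.dist v u) (r+1) with h | h
      · exact Or.inl ⟨hu.1, by omega⟩
      · exact Or.inr ⟨hu.1, by omega⟩
    have h1 := (Finset.card_le_card hsub).trans (Finset.card_union_le _ _)
    have h2 := ndl_sphere_card G hG v r
    obtain ⟨e, rfl⟩ : ∃ e, d = e + 3 := ⟨d - 3, by omega⟩
    simp only [show e + 3 - 1 = e + 2 by omega] at *
    rw [pow_succ]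
    have : 0 ≤ e * (e+2)^r := Nat.zero_le _
    nlinarith

lemma ndl_ball {n d : ℕ} (hd : 3 ≤ d) (G : SimpleGraph (Fin n)) [DecidableRel G.Adj]
    (hG : G.IsRegularOfDegree d) (v : Fin n) (r : ℕ) :
    Nat.card (GraphBall G v r) ≤ 3 * (d - 1) ^ r := by
  classical
  have := ndl_ball_aux hd G hG v r
  have h2 : Nat.card (GraphBall G v r) =
    (Finset.univ.filter (fun u => G.Reachable v u ∧ G.dist v u ≤ r)).card := by
    rw [Nat.card_eq_fintype_card, ← Fintype.card_subtype]
    exact Fintype.card_congr (Equiv.refl _)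
  omega

lemma ndl_sum_mulVec {n d : ℕ} (G : SimpleGraph (Fin n)) [DecidableRel G.Adj]
    (hG : G.IsRegularOfDegree d) (v : Fin n → ℝ) :
    ∑ i, (Matrix.mulVec (G.adjMatrix ℝ) v) i = d * ∑ i, v i := by
  simp only [Matrix.mulVec, dotProduct]
  rw [Finset.sum_comm, Finset.mul_sum]
  refine Finset.sum_congr rfl fun j _ => ?_
  rw [← Finset.sum_mul]
  congr 1
  have := hG j
  simp only [SimpleGraph.adjMatrix_apply, Finset.sum_boole]
  rw [← this, ← SimpleGraph.card_neighborFinset_eq_degree]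
  congr 2
  ext i
  simp [SimpleGraph.adj_comm]

lemma ndl_mulVec_const {n d : ℕ} (G : SimpleGraph (Fin n)) [DecidableRel G.Adj]
    (hG : G.IsRegularOfDegree d) (c : ℝ) :
    Matrix.mulVec (G.adjMatrix ℝ) (fun _ => c) = fun _ => d * c := by
  ext i
  rw [SimpleGraph.adjMatrix_mulVec_apply]
  simp [hG i]

lemma ndl_contract {n d : ℕ} {lam : ℝ} (G : SimpleGraph (Fin n)) [DecidableRel G.Adj]
    (hG : IsNDLGraph n d lam G) (hlam0 : 0 < lam) (hlamd : lam < d)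
    (w : Fin n → ℝ) (hw : ∑ i, w i = 0) :
    ∑ i, (Matrix.mulVec (G.adjMatrix ℝ) w i) ^ 2 ≤ lam ^ 2 * ∑ i, w i ^ 2 := by
  rcases Nat.eq_zero_or_pos n with rfl | hn
  · simp
  have hn' : (n : ℝ) ≠ 0 := by positivity
  have hH : (G.adjMatrix ℝ).IsHermitian := by
    rw [Matrix.IsHermitian, Matrix.conjTranspose_eq_transpose_of_trivial]
    exact G.isSymm_adjMatrix
  set A := G.adjMatrix ℝ with hA
  let b := hH.eigenvectorBasis
  have key : ∀ x : Fin n → ℝ, ∑ i, (∑ j, (b i) j * x j) ^ 2 = ∑ j, x j ^ 2 := by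
    intro x
    have := b.sum_sq_norm_inner_right (WithLp.toLp 2 x)
    rw [EuclideanSpace.norm_sq_eq] at this
    simp only [PiLp.inner_apply, Real.norm_eq_abs, sq_abs] at this
    simpa [mul_comm] using this
  have hev : ∀ i, Matrix.mulVec A (fun j => b i j) = hH.eigenvalues i • (fun j => b i j) :=
    fun i => hH.mulVec_eigenvectorBasis i
  have hsym : ∀ i, ∑ j, b i j * (Matrix.mulVec A w) j = hH.eigenvalues i * ∑ j, b i j * w j := by
    intro i
    have h1 : (fun j => b i j) ⬝ᵥ (Matrix.mulVec A w) = (Matrix.mulVec A (fun j => b i j)) ⬝ᵥ w := by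
      rw [Matrix.dotProduct_mulVec, ← Matrix.mulVec_transpose, G.transpose_adjMatrix]
    rw [hev i, smul_dotProduct] at h1
    simpa [dotProduct] using h1
  rw [← key (Matrix.mulVec A w), ← key w, Finset.mul_sum]
  refine Finset.sum_le_sum fun i _ => ?_
  rw [hsym i, mul_pow]
  have hne : ∀ i, (fun j => b i j) ≠ 0 := by
    intro i h
    apply b.orthonormal.ne_zero i
    ext j
    exact congrFun h j
  by_cases hs : ∑ j, b i j = 0
  · have := hG.2 _ _ (hne i) (hev i) hs
    have h2 : (hH.eigenvalues i)^2 ≤ lam^2 := by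
      rw [← sq_abs]; gcongr
    exact mul_le_mul_of_nonneg_right h2 (sq_nonneg _)
  · have hmu : hH.eigenvalues i = d := by
      have h1 := ndl_sum_mulVec G hG.1 (fun j => b i j)
      rw [← hA, hev i] at h1
      simp only [Pi.smul_apply, smul_eq_mul] at h1
      rw [← Finset.mul_sum] at h1
      exact mul_right_cancel₀ hs h1
    set c := (∑ j, b i j) / n with hc
    have hu : (fun j => b i j) - (fun _ => c) = 0 := by
      by_contra hne0
      have h3 := hG.2 d _ hne0 (by
        rw [← hA, Matrix.mulVec_sub, hev i, show A.mulVec (fun _ => c) = _ from ndl_mulVec_const G hG.1 c, hmu]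
        ext j; simp; ring) (by
        simp only [Pi.sub_apply, Finset.sum_sub_distrib]
        simp [hc]; field_simp; simp)
      rw [abs_of_nonneg (by positivity)] at h3
      linarith
    have hbc : ∀ j, b i j = c := fun j => by
      have := congrFun hu j
      simp at this; linarith
    have : ∑ j, b i j * w j = 0 := by
      simp only [hbc, ← Finset.mul_sum, hw, mul_zero]
    rw [this]; simp

lemma ndl_pow_support {n : ℕ} (G : SimpleGraph (Fin n)) [DecidableRel G.Adj] (s : Fin n)
    (k : ℕ) : ∀ t, ((G.adjMatrix ℝ) ^ k) t s ≠ 0 → G.Reachable s t ∧ G.dist s t ≤ k := by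
  intro t h
  rw [SimpleGraph.adjMatrix_pow_apply_eq_card_walk] at h
  have h' : Fintype.card {p : G.Walk t s | p.length = k} ≠ 0 := by exact_mod_cast h
  obtain ⟨⟨p, hp⟩⟩ := Fintype.card_pos_iff.1 (Nat.pos_of_ne_zero h')
  simp at hp
  refine ⟨p.reachable.symm, ?_⟩
  rw [SimpleGraph.dist_comm, ← hp]
  exact SimpleGraph.dist_le p

lemma ndl_main {n d : ℕ} {lam : ℝ} (G : SimpleGraph (Fin n)) [DecidableRel G.Adj]
    (hG : IsNDLGraph n d lam G) (hlam0 : 0 < lam) (hlamd : lam < d) (s : Fin n) (k : ℕ) :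
    ∑ t, (((G.adjMatrix ℝ) ^ k) t s - (d:ℝ)^k / n) = 0 ∧
    ∑ t, (((G.adjMatrix ℝ) ^ k) t s - (d:ℝ)^k / n)^2 ≤ (lam ^ 2) ^ k := by
  have hn : 0 < n := Fin.pos s
  have hn' : (n : ℝ) ≠ 0 := by positivity
  induction k with
  | zero =>
    refine ⟨by simp [Matrix.one_apply, hn'], ?_⟩
    have : ∀ t, (((G.adjMatrix ℝ) ^ 0) t s - (d:ℝ)^0 / n)^2 =
        (if t = s then (1:ℝ) else 0) * (1 - 2 / n) + 1 / n * (1 / n) := by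
      intro t
      by_cases h : t = s <;> simp [Matrix.one_apply, h] <;> ring
    simp only [this, Finset.sum_add_distrib, ← Finset.sum_mul]
    simp
    rw [mul_inv_cancel₀ hn']
    have : 0 < (n:ℝ)⁻¹ := by positivity
    have h2 : (2:ℝ) / n = 2 * (n:ℝ)⁻¹ := by ring
    linarith
  | succ k ih =>
    have hstep : (fun t => ((G.adjMatrix ℝ) ^ (k+1)) t s - (d:ℝ)^(k+1) / n) =
        Matrix.mulVec (G.adjMatrix ℝ) (fun t => ((G.adjMatrix ℝ) ^ k) t s - (d:ℝ)^k / n) := by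
      have : (fun t => ((G.adjMatrix ℝ) ^ k) t s - (d:ℝ)^k / n) =
        (fun t => ((G.adjMatrix ℝ) ^ k) t s) - fun _ => (d:ℝ)^k / n := rfl
      rw [this, Matrix.mulVec_sub, ndl_mulVec_const G hG.1]
      ext t
      simp only [Pi.sub_apply]
      rw [pow_succ', Matrix.mul_apply]
      simp only [Matrix.mulVec, dotProduct]
      ring
    constructor
    · rw [← mul_zero (d:ℝ), ← ih.1, ← ndl_sum_mulVec G hG.1]
      exact Finset.sum_congr rfl fun t _ => congrFun hstep t
    · have h1 := ndl_contract G hG hlam0 hlamd _ ih.1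
      rw [← hstep] at h1
      refine h1.trans ?_
      rw [pow_succ' (lam^2)]
      exact mul_le_mul_of_nonneg_left ih.2 (sq_nonneg _)

/-- If `G` is an `(n,d,λ)`-graph with `d ≥ 3` and `0 < λ < d`, `s` a vertex, `0 < δ < 1`, and
`r = ⌈(1/4)·log_{d/λ}(n/δ)⌉`, then for at least `(1−δ)n` vertices `t` one has
`dist(s,t) ≤ 2r` and each of the balls `B(s,r)`, `B(t,r)` has at most `3(d−1)^r` vertices
(so bidirectional BFS finds a shortest `s`-`t` path visiting at most `6(d−1)^r` vertices). -/
theorem stmt2 (n d : ℕ) (lam : ℝ) (G : SimpleGraph (Fin n)) [DecidableRel G.Adj]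
    (hG : IsNDLGraph n d lam G) (hd : 3 ≤ d) (hlam0 : 0 < lam) (hlamd : lam < d)
    (s : Fin n) (δ : ℝ) (hδ0 : 0 < δ) (hδ1 : δ < 1)
    (r : ℕ) (hr : r = ⌈(1 / 4 : ℝ) * (Real.log (n / δ) / Real.log (d / lam))⌉₊) :
    (1 - δ) * n ≤
      (Nat.card {t : Fin n //
        (G.Reachable s t ∧ G.dist s t ≤ 2 * r) ∧
        Nat.card (GraphBall G s r) ≤ 3 * (d - 1) ^ r ∧
        Nat.card (GraphBall G t r) ≤ 3 * (d - 1) ^ r} : ℝ) := by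
  classical
  have hn : 0 < n := Fin.pos s
  have hn' : (0 : ℝ) < n := by exact_mod_cast hn
  have hd0 : (0 : ℝ) < d := hlam0.trans hlamd
  set good := Finset.univ.filter (fun t => G.Reachable s t ∧ G.dist s t ≤ 2 * r) with hgood
  set bad := Finset.univ.filter (fun t => ¬ (G.Reachable s t ∧ G.dist s t ≤ 2 * r)) with hbad
  have hcard : Nat.card {t : Fin n //
        (G.Reachable s t ∧ G.dist s t ≤ 2 * r) ∧
        Nat.card (GraphBall G s r) ≤ 3 * (d - 1) ^ r ∧
        Nat.card (GraphBall G t r) ≤ 3 * (d - 1) ^ r} = good.card := by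
    rw [Nat.card_eq_fintype_card, Fintype.card_subtype]
    congr 1
    ext t
    simp only [hgood, Finset.mem_filter, Finset.mem_univ, true_and]
    exact ⟨fun h => h.1, fun h => ⟨h, ndl_ball hd G hG.1 s r, ndl_ball hd G hG.1 t r⟩⟩
  rw [hcard]
  have htot : good.card + bad.card = n := by
    have := Finset.card_filter_add_card_filter_not (s := (Finset.univ : Finset (Fin n)))
      (fun t => G.Reachable s t ∧ G.dist s t ≤ 2 * r)
    rwa [Finset.card_univ, Fintype.card_fin] at this
  have htot' : (good.card : ℝ) + bad.card = n := by exact_mod_cast htot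
  have hm := (ndl_main G hG hlam0 hlamd s (2 * r)).2
  have hb : (bad.card : ℝ) * ((d:ℝ)^(2*r) / n)^2 ≤ (lam^2)^(2*r) := by
    refine le_trans ?_ hm
    rw [← nsmul_eq_mul, ← Finset.sum_const]
    refine le_trans (Finset.sum_le_sum fun t ht => ?_)
      (Finset.sum_le_sum_of_subset_of_nonneg (Finset.subset_univ bad) fun _ _ _ => sq_nonneg _)
    have h0 : ((G.adjMatrix ℝ) ^ (2*r)) t s = 0 := by
      by_contra h
      exact (Finset.mem_filter.1 ht).2 (ndl_pow_support G s _ t h)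
    rw [h0]; simp
  have hlog : n / δ ≤ ((d:ℝ) / lam) ^ (4 * r) := by
    have h1 : 1 < (d:ℝ) / lam := by rwa [lt_div_iff₀ hlam0, one_mul]
    have hl := Real.log_pos h1
    have h2 : (1 / 4 : ℝ) * (Real.log (n / δ) / Real.log (d / lam)) ≤ r := by
      rw [hr]; exact Nat.le_ceil _
    have h3 : Real.log (n / δ) / Real.log (d / lam) ≤ 4 * r := by linarith
    rw [div_le_iff₀ hl] at h3
    rw [← Real.log_le_log_iff (by positivity) (by positivity), Real.log_pow]
    push_cast
    exact h3
  have hl4 : (lam^2)^(2*r) = lam^(4*r) := by rw [← pow_mul]; congr 1; ring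
  have hd4 : ((d:ℝ)^(2*r) / n)^2 = (d:ℝ)^(4*r) / n^2 := by
    rw [div_pow, ← pow_mul]; congr 2; ring
  rw [hl4, hd4] at hb
  rw [div_pow, div_le_div_iff₀ hδ0 (by positivity)] at hlog
  have hD : (0:ℝ) < (d:ℝ)^(4*r) := by positivity
  have hfin : (bad.card : ℝ) ≤ δ * n := by
    rw [← mul_div_assoc, div_le_iff₀ (by positivity)] at hb
    have h5 : (bad.card : ℝ) * (d:ℝ)^(4*r) ≤ (δ * n) * (d:ℝ)^(4*r) := by
      calc _ ≤ lam^(4*r) * n^2 := hb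
        _ = n * (n * lam^(4*r)) := by ring
        _ ≤ n * ((d:ℝ)^(4*r) * δ) := mul_le_mul_of_nonneg_left hlog hn'.le
        _ = _ := by ring
    exact le_of_mul_le_mul_right h5 hD
  linarith
end

section
/- Let G be a simple d-regular graph on n vertices with d ≥ 3 and n ≥ 3, and let s, t be vertices with dist(s,t) ≤ lg_{d−1} n + 3·lg_{d−1}(ln n). Then, setting r = ⌈dist(s,t)/2⌉, each of the balls B(s,r) and B(t,r) contains at most 3(d−1)·√n·(ln n)^{3/2} vertices; consequently bidirectional BFS between s and t finds a shortest s-t path after visiting at most 6(d−1)·√n·(ln n)^{3/2} vertices. -/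
lemma aux_pred {n : ℕ} (G : SimpleGraph (Fin n)) (s v : Fin n) (k : ℕ)
    (h : G.Reachable s v) (hk : G.dist s v = k + 1) :
    ∃ w, G.Adj v w ∧ G.Reachable s w ∧ G.dist s w = k := by
  obtain ⟨p, hp⟩ := h.symm.exists_walk_length_eq_dist
  rw [SimpleGraph.dist_comm, hk] at hp
  cases p with
  | nil => simp at hp
  | cons hadj p =>
    rename_i w
    simp only [SimpleGraph.Walk.length_cons, Nat.add_right_cancel_iff] at hp
    have hw : G.Reachable s w := p.reachable.symm
    refine ⟨w, hadj, hw, ?_⟩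
    have h1 := SimpleGraph.dist_le p.reverse
    rw [SimpleGraph.Walk.length_reverse, hp] at h1
    obtain ⟨q, hq⟩ := hw.exists_walk_length_eq_dist
    have h2 := SimpleGraph.dist_le (q.concat hadj.symm)
    rw [SimpleGraph.Walk.length_concat, hq, hk] at h2
    omega

open Classical in
noncomputable def auxS {n : ℕ} (G : SimpleGraph (Fin n)) (s : Fin n) (k : ℕ) : Finset (Fin n) :=
  Finset.univ.filter fun u => G.Reachable s u ∧ G.dist s u = k

lemma aux_mem {n : ℕ} (G : SimpleGraph (Fin n)) (s u : Fin n) (k : ℕ) :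
    u ∈ auxS G s k ↔ G.Reachable s u ∧ G.dist s u = k := by
  simp [auxS]

lemma aux_sphere {n q : ℕ} (G : SimpleGraph (Fin n)) [DecidableRel G.Adj]
    (hreg : G.IsRegularOfDegree (q + 1)) (s : Fin n) (k : ℕ) :
    (auxS G s (k + 1)).card ≤ (q + 1) * q ^ k := by
  induction k with
  | zero =>
    have hsub : auxS G s 1 ⊆ G.neighborFinset s := by
      intro u hu
      obtain ⟨h1, h2⟩ := (aux_mem _ _ _ _).1 hu
      simpa using SimpleGraph.dist_eq_one_iff_adj.1 h2
    have := Finset.card_le_card hsub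
    rw [SimpleGraph.card_neighborFinset_eq_degree, hreg s] at this
    simpa using this
  | succ k ih =>
    have hsub : auxS G s (k + 2) ⊆
        (auxS G s (k + 1)).biUnion fun v => G.neighborFinset v \ auxS G s k := by
      intro u hu
      obtain ⟨h1, h2⟩ := (aux_mem _ _ _ _).1 hu
      obtain ⟨w, hw, hw1, hw2⟩ := aux_pred G s u (k + 1) h1 h2
      rw [Finset.mem_biUnion]
      refine ⟨w, (aux_mem _ _ _ _).2 ⟨hw1, hw2⟩, ?_⟩
      rw [Finset.mem_sdiff, aux_mem]
      refine ⟨by simpa using hw.symm, fun h => ?_⟩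
      omega
    have hb := Finset.card_biUnion_le_card_mul (auxS G s (k + 1))
      (fun v => G.neighborFinset v \ auxS G s k) q (by
        intro v hv
        obtain ⟨h1, h2⟩ := (aux_mem _ _ _ _).1 hv
        obtain ⟨w, hw, hw1, hw2⟩ := aux_pred G s v k h1 h2
        have hlt : (G.neighborFinset v \ auxS G s k).card < (G.neighborFinset v).card := by
          apply Finset.card_lt_card
          refine Finset.ssubset_iff_subset_ne.2 ⟨Finset.sdiff_subset, fun h => ?_⟩
          have hwm : w ∈ G.neighborFinset v := by simpa using hw
          rw [← h, Finset.mem_sdiff, aux_mem] at hwm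
          exact hwm.2 ⟨hw1, hw2⟩
        rw [SimpleGraph.card_neighborFinset_eq_degree, hreg v] at hlt
        omega)
    calc _ ≤ _ := Finset.card_le_card hsub
      _ ≤ _ := hb
      _ ≤ (q + 1) * q ^ k * q := Nat.mul_le_mul_right _ ih
      _ = _ := by ring

lemma aux_ball {n q : ℕ} (G : SimpleGraph (Fin n)) [DecidableRel G.Adj]
    (hreg : G.IsRegularOfDegree (q + 1)) (hq : 2 ≤ q) (s : Fin n) (r : ℕ) :
    Nat.card (GraphBall G s r) ≤ 3 * q ^ r := by
  have key : (GraphBall G s r).ncard ≤ 3 * q ^ r := by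
    induction r with
    | zero =>
      have : GraphBall G s 0 ⊆ {s} := by
        rintro u ⟨h1, h2⟩
        have := (h1.dist_eq_zero_iff).1 (Nat.le_zero.1 h2)
        simp [this]
      have := Set.ncard_le_ncard this
      rw [Set.ncard_singleton] at this
      rw [pow_zero]
      omega
    | succ k ih =>
      have hsub : GraphBall G s (k + 1) ⊆ GraphBall G s k ∪ (auxS G s (k + 1) : Set (Fin n)) := by
        rintro u ⟨h1, h2⟩
        by_cases h : G.dist s u ≤ k
        · exact Or.inl ⟨h1, h⟩
        · exact Or.inr ((aux_mem _ _ _ _).2 ⟨h1, by omega⟩)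
      have h1 := Set.ncard_le_ncard hsub
      have h2 := Set.ncard_union_le (GraphBall G s k) (auxS G s (k + 1) : Set (Fin n))
      rw [Set.ncard_coe_finset] at h2
      have h3 := aux_sphere G hreg s k
      have h4 : 2 * q ^ k ≤ q * q ^ k := Nat.mul_le_mul_right _ hq
      rw [pow_succ]
      nlinarith
  simpa [Set.ncard] using key

lemma aux_pow (n d D r : ℕ) (hd : 3 ≤ d) (hn : 3 ≤ n)
    (hdist : (D : ℝ) ≤
      Real.log n / Real.log (d - 1) + 3 * (Real.log (Real.log n) / Real.log (d - 1)))
    (hr : r = ⌈(D : ℝ) / 2⌉₊) :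
    ((d : ℝ) - 1) ^ r ≤ ((d : ℝ) - 1) * Real.sqrt n * Real.log n ^ ((3 : ℝ) / 2) := by
  have hd' : (3 : ℝ) ≤ d := by exact_mod_cast hd
  have hn' : (3 : ℝ) ≤ n := by exact_mod_cast hn
  have hq : (1 : ℝ) < (d : ℝ) - 1 := by linarith
  have hL : 0 < Real.log ((d : ℝ) - 1) := Real.log_pos hq
  have hln : 0 < Real.log n := Real.log_pos (by linarith)
  have hr2 : (r : ℝ) ≤ ((D : ℝ) + 1) / 2 := by
    have hle : 2 * r ≤ D + 1 := by
      have : r ≤ (D + 1) / 2 := by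
        rw [hr, Nat.ceil_le]
        have h : D ≤ 2 * ((D + 1) / 2) := by omega
        have h' : (D : ℝ) ≤ 2 * (((D + 1) / 2 : ℕ) : ℝ) := by exact_mod_cast h
        linarith
      omega
    have : (2 : ℝ) * r ≤ D + 1 := by exact_mod_cast hle
    linarith
  have hD : (D : ℝ) * Real.log ((d : ℝ) - 1) ≤ Real.log n + 3 * Real.log (Real.log n) := by
    have h := mul_le_mul_of_nonneg_right hdist hL.le
    have e : (Real.log n / Real.log ((d : ℝ) - 1)
        + 3 * (Real.log (Real.log n) / Real.log ((d : ℝ) - 1))) * Real.log ((d : ℝ) - 1)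
        = Real.log n + 3 * Real.log (Real.log n) := by
      field_simp
    linarith
  have hs : 0 < Real.sqrt n := Real.sqrt_pos.2 (by linarith)
  have hp : 0 < Real.log n ^ ((3 : ℝ) / 2) := Real.rpow_pos_of_pos hln _
  have hq0 : (0 : ℝ) < (d : ℝ) - 1 := by linarith
  rw [← Real.log_le_log_iff (by positivity) (by positivity), Real.log_pow,
    Real.log_mul (by positivity) hp.ne', Real.log_mul hq0.ne' hs.ne', Real.log_sqrt (by linarith),
    Real.log_rpow hln]
  nlinarith

/-- If `G` is a simple `d`-regular graph on `n ≥ 3` vertices with `d ≥ 3`, and `s`, `t` are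
vertices at (finite) distance at most `log_{d−1} n + 3·log_{d−1}(ln n)`, then with
`r = ⌈dist(s,t)/2⌉` each of the balls `B(s,r)` and `B(t,r)` contains at most
`3(d−1)·√n·(ln n)^{3/2}` vertices (so bidirectional BFS between `s` and `t` finds a
shortest `s`-`t` path after visiting at most `6(d−1)·√n·(ln n)^{3/2}` vertices). -/
theorem stmt4 (n d : ℕ) (G : SimpleGraph (Fin n)) [DecidableRel G.Adj]
    (hreg : G.IsRegularOfDegree d) (hd : 3 ≤ d) (hn : 3 ≤ n)
    (s t : Fin n) (hreach : G.Reachable s t)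
    (hdist : (G.dist s t : ℝ) ≤
      Real.log n / Real.log (d - 1) + 3 * (Real.log (Real.log n) / Real.log (d - 1)))
    (r : ℕ) (hr : r = ⌈(G.dist s t : ℝ) / 2⌉₊) :
    (Nat.card (GraphBall G s r) : ℝ)
        ≤ 3 * ((d : ℝ) - 1) * Real.sqrt n * Real.log n ^ ((3 : ℝ) / 2) ∧
    (Nat.card (GraphBall G t r) : ℝ)
        ≤ 3 * ((d : ℝ) - 1) * Real.sqrt n * Real.log n ^ ((3 : ℝ) / 2) := by
  have hc : ((d - 1 : ℕ) : ℝ) = (d : ℝ) - 1 := by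
    rw [Nat.cast_sub (by omega)]
    simp
  have hreg' : G.IsRegularOfDegree ((d - 1) + 1) := by
    rwa [Nat.sub_add_cancel (by omega)]
  have hpow := aux_pow n d (G.dist s t) r hd hn hdist hr
  have main : ∀ v : Fin n, (Nat.card (GraphBall G v r) : ℝ)
      ≤ 3 * ((d : ℝ) - 1) * Real.sqrt n * Real.log n ^ ((3 : ℝ) / 2) := by
    intro v
    have h1 : (Nat.card (GraphBall G v r) : ℝ) ≤ 3 * ((d - 1 : ℕ) : ℝ) ^ r := by
      exact_mod_cast aux_ball G hreg' (by omega) v r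
    rw [hc] at h1
    linarith
  exact ⟨main s, main t⟩
end

section
/- Let G be an (n,d,λ)-graph with 0 < λ ≤ d/2, let S be a set of k ≥ 1 vertices, let t be any vertex, and let m be a positive integer with m ≥ lg_{d/λ} n. Then the number of walks of length 3m starting at t whose last m+1 vertices (the vertices in positions 2m, 2m+1, …, 3m) all lie outside S is at most d^{3m}·exp(−m·k/(2n) + 1/n). Equivalently, a uniformly random walk of length 3m from t avoids S on its final m+1 vertices with probability at most exp(−m·k/(2n) + 1/n). -/
/-- `w : Fin (L+1) → V` is a walk of length `L` in `G`: a sequence of `L+1` vertices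
in which consecutive vertices are adjacent. -/
def IsWalkSeq {n : ℕ} (G : SimpleGraph (Fin n)) (L : ℕ) (w : Fin (L + 1) → Fin n) : Prop :=
  ∀ i : Fin L, G.Adj (w i.castSucc) (w i.succ)

open Matrix in
theorem aux_herm {n : ℕ} (C : Matrix (Fin n) (Fin n) ℝ) (hC : C.IsHermitian) (c : ℝ)
    (h : ∀ (μ : ℝ) (v : Fin n → ℝ), v ≠ 0 → C *ᵥ v = μ • v → |μ| ≤ c) (x : Fin n → ℝ) :
    ∑ i, (C *ᵥ x) i ^ 2 ≤ c ^ 2 * ∑ i, x i ^ 2 := by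
  have key : ∀ y : Fin n → ℝ, ∑ i, y i ^ 2 = ∑ j, ((hC.eigenvectorBasis j : Fin n → ℝ) ⬝ᵥ y) ^ 2 := by
    intro y
    have := hC.eigenvectorBasis.sum_sq_norm_inner_right (WithLp.toLp 2 y)
    rw [EuclideanSpace.norm_sq_eq] at this
    simp only [Real.norm_eq_abs, sq_abs, PiLp.toLp_apply] at this
    rw [← this]
    refine Finset.sum_congr rfl fun j _ => ?_
    congr 1
    simp [PiLp.inner_apply, dotProduct, mul_comm]
  rw [key (C *ᵥ x), key x, Finset.mul_sum]
  refine Finset.sum_le_sum fun j _ => ?_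
  have h1 := hC.mulVec_eigenvectorBasis j
  have h2 : (hC.eigenvectorBasis j : Fin n → ℝ) ⬝ᵥ (C *ᵥ x)
      = hC.eigenvalues j * ((hC.eigenvectorBasis j : Fin n → ℝ) ⬝ᵥ x) := by
    rw [dotProduct_mulVec, ← mulVec_transpose]
    have : Cᵀ = C := by simpa [IsHermitian] using hC
    rw [this, h1, smul_dotProduct, smul_eq_mul]
  rw [h2, mul_pow]
  have h3 : |hC.eigenvalues j| ≤ c := by
    refine h _ _ ?_ h1
    intro h0
    apply hC.eigenvectorBasis.toBasis.ne_zero j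
    ext i
    simpa using congrFun h0 i
  have : hC.eigenvalues j ^ 2 ≤ c ^ 2 := sq_le_sq' (by linarith [neg_abs_le (hC.eigenvalues j)]) (by linarith [le_abs_self (hC.eigenvalues j)])
  gcongr

open Matrix in
theorem aux_sum {n d : ℕ} (G : SimpleGraph (Fin n)) [DecidableRel G.Adj]
    (hd : G.IsRegularOfDegree d) (x : Fin n → ℝ) :
    ∑ i, (G.adjMatrix ℝ *ᵥ x) i = d * ∑ i, x i := by
  have h : ∀ j, ∑ i, G.adjMatrix ℝ i j = d := by
    intro j
    have : ∑ i, G.adjMatrix ℝ i j = ∑ i, if G.Adj j i then (1:ℝ) else 0 := by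
      refine Finset.sum_congr rfl fun i _ => ?_
      simp [SimpleGraph.adjMatrix_apply, G.adj_comm]
    rw [this, Finset.sum_boole, ← hd j, ← SimpleGraph.card_neighborFinset_eq_degree,
      SimpleGraph.neighborFinset_eq_filter]
  simp only [mulVec, dotProduct]
  rw [Finset.sum_comm, Finset.mul_sum]
  refine Finset.sum_congr rfl fun j _ => ?_
  rw [← Finset.sum_mul, h]

open Matrix in
theorem aux_C {n d : ℕ} {lam : ℝ} (G : SimpleGraph (Fin n)) [DecidableRel G.Adj] (hn : 0 < n)
    (hG : IsNDLGraph n d lam G) (c b : ℝ) (hb : lam ≤ b) (hb' : |d - c| ≤ b) (x : Fin n → ℝ) :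
    ∑ i, ((G.adjMatrix ℝ *ᵥ x) i - c / n * ∑ j, x j) ^ 2 ≤ b ^ 2 * ∑ i, x i ^ 2 := by
  set C : Matrix (Fin n) (Fin n) ℝ := G.adjMatrix ℝ - Matrix.of (fun _ _ => c / n) with hCdef
  have hCx : ∀ x : Fin n → ℝ, ∀ i, (C *ᵥ x) i = (G.adjMatrix ℝ *ᵥ x) i - c / n * ∑ j, x j := by
    intro x i
    rw [hCdef, sub_mulVec, Pi.sub_apply]
    congr 1
    simp [mulVec, dotProduct, Finset.mul_sum]
  have hC : C.IsHermitian := by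
    ext i j
    simp [hCdef, SimpleGraph.adjMatrix_apply, G.adj_comm]
  have := aux_herm C hC b ?_ x
  · simpa only [hCx] using this
  intro μ v hv hμ
  have hs : (d - c) * ∑ i, v i = μ * ∑ i, v i := by
    have h1 : ∑ i, (C *ᵥ v) i = ∑ i, (μ • v) i := by rw [hμ]
    simp only [hCx, Pi.smul_apply, smul_eq_mul, Finset.sum_sub_distrib, aux_sum G hG.1,
      ← Finset.mul_sum] at h1
    rw [← h1]
    simp
    field_simp
  by_cases h0 : ∑ i, v i = 0
  · refine le_trans (hG.2 μ v hv ?_ h0) hb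
    rw [← hμ]
    ext i
    rw [hCx, h0]; simp
  · rw [← mul_right_cancel₀ h0 hs]; exact hb'

open Matrix in
theorem aux_pow_s5 {n d : ℕ} {lam : ℝ} (G : SimpleGraph (Fin n)) [DecidableRel G.Adj] (hn : 0 < n)
    (hG : IsNDLGraph n d lam G) (h0 : 0 < lam) (x : Fin n → ℝ) (hx : ∑ i, x i = 0) (L : ℕ) :
    ∑ i, (((G.adjMatrix ℝ *ᵥ ·)^[L]) x) i = 0 ∧
    ∑ i, (((G.adjMatrix ℝ *ᵥ ·)^[L]) x) i ^ 2 ≤ (lam ^ L) ^ 2 * ∑ i, x i ^ 2 := by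
  induction L with
  | zero => simp [hx]
  | succ L ih =>
    rw [Function.iterate_succ_apply']
    obtain ⟨h1, h2⟩ := ih
    refine ⟨by rw [aux_sum G hG.1, h1, mul_zero], ?_⟩
    have := aux_C G hn hG d lam le_rfl (by simpa using h0.le) ((G.adjMatrix ℝ *ᵥ ·)^[L] x)
    rw [h1] at this
    simp only [mul_zero, sub_zero] at this
    refine this.trans ?_
    calc _ ≤ lam ^ 2 * ((lam ^ L) ^ 2 * ∑ i, x i ^ 2) := by gcongr
      _ = _ := by ring

open Matrix in
theorem aux_iter_add {n d : ℕ} (G : SimpleGraph (Fin n)) [DecidableRel G.Adj]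
    (hd : G.IsRegularOfDegree d) (x : Fin n → ℝ) (a : ℝ) (L : ℕ) (i : Fin n) :
    ((G.adjMatrix ℝ *ᵥ ·)^[L] (fun j => x j + a)) i
      = ((G.adjMatrix ℝ *ᵥ ·)^[L] x) i + d ^ L * a := by
  induction L generalizing i with
  | zero => simp
  | succ L ih =>
    rw [Function.iterate_succ_apply', Function.iterate_succ_apply']
    have : (G.adjMatrix ℝ *ᵥ ·)^[L] (fun j => x j + a)
       = fun i => ((G.adjMatrix ℝ *ᵥ ·)^[L] x) i + d ^ L * a := funext ih
    rw [this]
    simp only [SimpleGraph.adjMatrix_mulVec_apply, Finset.sum_add_distrib, Finset.sum_const,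
      SimpleGraph.card_neighborFinset_eq_degree, hd i]
    simp; ring

/-- one step of the restricted chain -/
noncomputable def stepT {n : ℕ} (G : SimpleGraph (Fin n)) [DecidableRel G.Adj]
    (S : Finset (Fin n)) (x : Fin n → ℝ) : Fin n → ℝ :=
  fun i => if i ∈ S then 0 else Matrix.mulVec (G.adjMatrix ℝ) x i

open Matrix in
theorem aux_step {n d : ℕ} {lam : ℝ} (G : SimpleGraph (Fin n)) [DecidableRel G.Adj] (hn : 0 < n)
    (hG : IsNDLGraph n d lam G) (hld : lam ≤ d / 2) (S : Finset (Fin n)) (x : Fin n → ℝ)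
    (hx : ∀ i ∈ S, x i = 0) :
    ∑ i, stepT G S x i ^ 2 ≤ (d * (1 - S.card / (2 * n))) ^ 2 * ∑ i, x i ^ 2 := by
  have hn' : (0:ℝ) < n := by exact_mod_cast hn
  have hcard : (S.card : ℝ) ≤ n := by
    have := Finset.card_le_univ S
    rw [Fintype.card_fin] at this
    exact_mod_cast this
  set y := stepT G S x with hy
  have hyS : ∀ i ∈ S, y i = 0 := fun i hi => by simp [hy, stepT, hi]
  have hC := aux_C G hn hG (d / 2) (d / 2) hld (by rw [abs_of_nonneg] <;> linarith [Nat.cast_nonneg (α := ℝ) d]) x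
  have hcs : ∀ z : Fin n → ℝ, (∀ i ∈ S, z i = 0) →
      (∑ i, z i) ^ 2 ≤ (n - S.card) * ∑ i, z i ^ 2 := by
    intro z hz
    have e1 : ∑ i, z i = ∑ i ∈ Sᶜ, z i :=
      (Finset.sum_subset (Finset.subset_univ _) (fun i _ hi => hz i (by simpa using hi))).symm
    have e2 : ∑ i, z i ^ 2 = ∑ i ∈ Sᶜ, z i ^ 2 :=
      (Finset.sum_subset (Finset.subset_univ _) (fun i _ hi => by rw [hz i (by simpa using hi)]; simp)).symm
    rw [e1, e2]
    have := sq_sum_le_card_mul_sum_sq (s := Sᶜ) (f := z)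
    rwa [Finset.card_compl, Fintype.card_fin, Nat.cast_sub (by exact_mod_cast hcard)] at this
  set X := ∑ i, x i ^ 2 with hX
  set Y := ∑ i, y i ^ 2 with hY
  have hX0 : 0 ≤ X := Finset.sum_nonneg fun i _ => sq_nonneg _
  have hY0 : 0 ≤ Y := Finset.sum_nonneg fun i _ => sq_nonneg _
  have hYeq : Y = ∑ i, y i * ((G.adjMatrix ℝ *ᵥ x) i - (d/2:ℝ) / n * ∑ j, x j)
      + (d/2:ℝ) / n * ((∑ j, x j) * ∑ i, y i) := by
    have : Y = ∑ i, y i * (G.adjMatrix ℝ *ᵥ x) i := by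
      refine Finset.sum_congr rfl fun i _ => ?_
      by_cases hi : i ∈ S
      · simp [hyS i hi]
      · have : y i = (G.adjMatrix ℝ *ᵥ x) i := by simp [hy, stepT, hi]
        rw [← this]; ring
    rw [this]
    simp only [mul_sub, Finset.sum_sub_distrib, ← Finset.sum_mul]
    ring
  have hd0 : (0:ℝ) ≤ d := Nat.cast_nonneg _
  have hr : √X * √Y * (√X * √Y) = X * Y := by
    rw [mul_mul_mul_comm, Real.mul_self_sqrt hX0, Real.mul_self_sqrt hY0]
  have hr0 : 0 ≤ √X * √Y := by positivity
  have b1 : ∑ i, y i * ((G.adjMatrix ℝ *ᵥ x) i - (d/2:ℝ) / n * ∑ j, x j) ≤ d / 2 * (√X * √Y) := by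
    apply (abs_le_of_sq_le_sq' _ (by positivity)).2
    refine (Finset.sum_mul_sq_le_sq_mul_sq _ _ _).trans ?_
    calc _ ≤ Y * ((d / 2) ^ 2 * X) := by gcongr
      _ = (d / 2) ^ 2 * (X * Y) := by ring
      _ = _ := by rw [← hr]; ring
  have b2 : (∑ j, x j) * ∑ i, y i ≤ (n - S.card) * (√X * √Y) := by
    have h1 := hcs x hx
    have h2 := hcs y hyS
    apply abs_le_of_sq_le_sq' _ (mul_nonneg (by linarith) hr0) |>.2
    calc ((∑ j, x j) * ∑ i, y i) ^ 2 = (∑ j, x j)^2 * (∑ i, y i) ^ 2 := by ring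
      _ ≤ ((n - S.card) * X) * ((n - S.card) * Y) := by gcongr
      _ = (n - S.card)^2 * (X * Y) := by ring
      _ = _ := by rw [← hr]; ring
  have b3 : Y ≤ d * (1 - S.card / (2 * n)) * (√X * √Y) := by
    refine hYeq.le.trans ?_
    calc _ ≤ d / 2 * (√X * √Y) + (d/2:ℝ) / n * ((n - S.card) * (√X * √Y)) := by gcongr
      _ = _ := by field_simp; ring
  set K := d * (1 - (S.card:ℝ) / (2 * n)) with hK
  rcases hY0.eq_or_lt with h | h
  · rw [← h]; positivity
  · have hsY : 0 < √Y := Real.sqrt_pos.2 h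
    have : √Y ≤ K * √X := by
      have : √Y * √Y ≤ (K * √X) * √Y := by rw [Real.mul_self_sqrt hY0]; linarith
      exact le_of_mul_le_mul_right this hsY
    calc Y = √Y ^ 2 := (Real.sq_sqrt hY0).symm
      _ ≤ (K * √X) ^ 2 := by gcongr
      _ = _ := by rw [mul_pow, Real.sq_sqrt hX0]

open Classical in
/-- number of walks -/
noncomputable def cnt {n : ℕ} (G : SimpleGraph (Fin n)) (S : Finset (Fin n)) (L j : ℕ)
    (t : Fin n) : ℕ :=
  (Finset.univ.filter fun w : Fin (L + 1) → Fin n =>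
    IsWalkSeq G L w ∧ w 0 = t ∧ ∀ i : Fin (L + 1), j ≤ (i : ℕ) → w i ∉ S).card

open Matrix in
theorem cnt_succ {n : ℕ} (G : SimpleGraph (Fin n)) [DecidableRel G.Adj] (S : Finset (Fin n))
    (L j : ℕ) (t : Fin n) :
    (cnt G S (L + 1) j t : ℝ) ≤ (G.adjMatrix ℝ *ᵥ fun s => (cnt G S L (j - 1) s : ℝ)) t := by
  classical
  rw [SimpleGraph.adjMatrix_mulVec_apply]
  have : cnt G S (L + 1) j t ≤ ∑ s ∈ G.neighborFinset t, cnt G S L (j - 1) s := by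
    unfold cnt
    calc _ ≤ ((G.neighborFinset t).biUnion fun s =>
          (Finset.univ.filter fun w : Fin (L + 1) → Fin n =>
            IsWalkSeq G L w ∧ w 0 = s ∧ ∀ i : Fin (L + 1), j - 1 ≤ (i : ℕ) → w i ∉ S).image
              (fun w => (Fin.cons t w : Fin (L + 2) → Fin n))).card := by
          apply Finset.card_le_card
          intro w hw
          simp only [Finset.mem_filter, Finset.mem_univ, true_and] at hw
          obtain ⟨h1, h2, h3⟩ := hw
          simp only [Finset.mem_biUnion, Finset.mem_image, Finset.mem_filter, Finset.mem_univ,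
            true_and, SimpleGraph.mem_neighborFinset]
          refine ⟨w 1, ?_, Fin.tail w, ⟨?_, rfl, ?_⟩, ?_⟩
          · have := h1 0
            rw [← h2]; exact this
          · intro i
            exact h1 i.succ
          · intro i hi
            exact h3 i.succ (by simp; omega)
          · rw [← h2]; exact Fin.cons_self_tail w
      _ ≤ _ := Finset.card_biUnion_le.trans (Finset.sum_le_sum fun s _ => Finset.card_image_le)
  exact_mod_cast this

theorem cnt_zero_mem {n : ℕ} (G : SimpleGraph (Fin n)) (S : Finset (Fin n))
    (L : ℕ) (t : Fin n) (ht : t ∈ S) : cnt G S L 0 t = 0 := by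
  classical
  unfold cnt
  rw [Finset.card_eq_zero, Finset.filter_eq_empty_iff]
  rintro w - ⟨-, h2, h3⟩
  exact h3 0 (Nat.zero_le _) (h2 ▸ ht)

theorem cnt_zero_le {n : ℕ} (G : SimpleGraph (Fin n)) (S : Finset (Fin n))
    (t : Fin n) : cnt G S 0 0 t ≤ 1 := by
  classical
  unfold cnt
  rw [Finset.card_le_one]
  intro a ha b hb
  simp only [Finset.mem_filter, Finset.mem_univ, true_and] at ha hb
  funext i
  have : i = 0 := Fin.ext (by have := i.2; simp)
  rw [this, ha.2.1, hb.2.1]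

open Matrix in
theorem mulVec_mono' {n : ℕ} (G : SimpleGraph (Fin n)) [DecidableRel G.Adj] (x y : Fin n → ℝ)
    (h : ∀ i, x i ≤ y i) (i : Fin n) : (G.adjMatrix ℝ *ᵥ x) i ≤ (G.adjMatrix ℝ *ᵥ y) i := by
  rw [SimpleGraph.adjMatrix_mulVec_apply, SimpleGraph.adjMatrix_mulVec_apply]
  exact Finset.sum_le_sum fun j _ => h j

theorem cnt_le_step {n : ℕ} (G : SimpleGraph (Fin n)) [DecidableRel G.Adj] (S : Finset (Fin n))
    (m : ℕ) (t : Fin n) :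
    (cnt G S m 0 t : ℝ) ≤ ((stepT G S)^[m] (fun i => if i ∈ S then 0 else 1)) t := by
  induction m generalizing t with
  | zero =>
    by_cases ht : t ∈ S
    · simp [ht, cnt_zero_mem]
    · simpa [ht] using cnt_zero_le G S t
  | succ m ih =>
    rw [Function.iterate_succ_apply']
    by_cases ht : t ∈ S
    · simp [ht, cnt_zero_mem, stepT]
    · have h1 := cnt_succ G S m 0 t
      refine h1.trans ?_
      rw [stepT, if_neg ht]
      exact mulVec_mono' G _ _ ih t

open Matrix in
theorem cnt_le_iter {n : ℕ} (G : SimpleGraph (Fin n)) [DecidableRel G.Adj] (S : Finset (Fin n))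
    (m j : ℕ) (t : Fin n) :
    (cnt G S (m + j) j t : ℝ) ≤ ((G.adjMatrix ℝ *ᵥ ·)^[j]
      ((stepT G S)^[m] (fun i => if i ∈ S then 0 else 1))) t := by
  induction j generalizing t with
  | zero => simpa using cnt_le_step G S m t
  | succ j ih =>
    rw [Function.iterate_succ_apply']
    exact (cnt_succ G S (m + j) (j + 1) t).trans (mulVec_mono' G _ _ ih t)

theorem aux_g {n d : ℕ} {lam : ℝ} (G : SimpleGraph (Fin n)) [DecidableRel G.Adj] (hn : 0 < n)
    (hG : IsNDLGraph n d lam G) (hld : lam ≤ d / 2) (S : Finset (Fin n)) (m : ℕ)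
    (g : Fin n → ℝ) (hg : g = (stepT G S)^[m] (fun i => if i ∈ S then 0 else 1)) :
    (∀ i ∈ S, g i = 0) ∧ (∀ i, 0 ≤ g i) ∧
      ∑ i, g i ^ 2 ≤ ((d * (1 - S.card / (2 * n))) ^ m) ^ 2 * n := by
  induction m generalizing g with
  | zero =>
    subst hg
    refine ⟨fun i hi => by simp [hi], fun i => ?_, ?_⟩
    · simp only [Function.iterate_zero, id]; split_ifs <;> simp
    · simp only [Function.iterate_zero, id, pow_zero, one_pow, one_mul]
      calc _ ≤ ∑ i : Fin n, (1:ℝ) := by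
            refine Finset.sum_le_sum fun i _ => ?_
            split_ifs <;> simp
        _ = n := by simp
  | succ m ih =>
    obtain ⟨h1, h2, h3⟩ := ih _ rfl
    rw [Function.iterate_succ_apply'] at hg
    subst hg
    refine ⟨fun i hi => by simp [stepT, hi], fun i => ?_, ?_⟩
    · unfold stepT
      split_ifs
      · exact le_rfl
      · rw [SimpleGraph.adjMatrix_mulVec_apply]
        exact Finset.sum_nonneg fun j _ => h2 j
    · refine (aux_step G hn hG hld S _ h1).trans ?_
      calc _ ≤ (d * (1 - (S.card:ℝ) / (2 * n))) ^ 2 * (((d * (1 - S.card / (2 * n))) ^ m) ^ 2 * n) := by gcongr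
        _ = _ := by ring

theorem stmt5 (n d : ℕ) (lam : ℝ) (G : SimpleGraph (Fin n)) [DecidableRel G.Adj]
    (hG : IsNDLGraph n d lam G) (hlam0 : 0 < lam) (hlamd : lam ≤ d / 2)
    (S : Finset (Fin n)) (k : ℕ) (hk : 1 ≤ k) (hS : S.card = k) (t : Fin n)
    (m : ℕ) (hm : 0 < m) (hmlog : Real.log n / Real.log (d / lam) ≤ (m : ℝ)) :
    (Nat.card {w : Fin (3 * m + 1) → Fin n //
        IsWalkSeq G (3 * m) w ∧ w 0 = t ∧
        ∀ i : Fin (3 * m + 1), 2 * m ≤ (i : ℕ) → w i ∉ S} : ℝ)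
      ≤ (d : ℝ) ^ (3 * m) * Real.exp (-((m : ℝ) * k) / (2 * n) + 1 / n) := by
  have hn : 0 < n := Fin.pos t
  have hn' : (0:ℝ) < n := by exact_mod_cast hn
  have hd0 : (0:ℝ) < d := by linarith
  have hcard : (S.card : ℝ) ≤ n := by
    have := Finset.card_le_univ S
    rw [Fintype.card_fin] at this
    exact_mod_cast this
  have hcnt : Nat.card {w : Fin (3 * m + 1) → Fin n //
        IsWalkSeq G (3 * m) w ∧ w 0 = t ∧
        ∀ i : Fin (3 * m + 1), 2 * m ≤ (i : ℕ) → w i ∉ S} = cnt G S (m + 2 * m) (2 * m) t := by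
    classical
    rw [show m + 2 * m = 3 * m by ring, Nat.card_eq_fintype_card, Fintype.card_subtype]
    unfold cnt
    congr
  rw [hcnt]
  refine (cnt_le_iter G S m (2 * m) t).trans ?_
  generalize hg : (stepT G S)^[m] (fun i => if i ∈ S then (0:ℝ) else 1) = g
  obtain ⟨-, g0, g2⟩ := aux_g G hn hG hlamd S m g hg.symm
  set K := (d * (1 - (S.card:ℝ) / (2 * n))) with hKdef
  have hb1 : (S.card:ℝ) / (2 * n) ≤ 1 := by
    rw [div_le_one (by positivity)]; linarith
  have hK : 0 ≤ K := mul_nonneg hd0.le (by linarith)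
  set s := ∑ i, g i with hs
  have hs0 : 0 ≤ s := Finset.sum_nonneg fun i _ => g0 i
  have hsK : s ≤ n * K ^ m := by
    apply (abs_le_of_sq_le_sq' _ (by positivity)).2
    have := sq_sum_le_card_mul_sum_sq (s := Finset.univ) (f := g)
    rw [Finset.card_univ, Fintype.card_fin] at this
    calc s ^ 2 ≤ n * ∑ i, g i ^ 2 := this
      _ ≤ n * ((K ^ m) ^ 2 * n) := by gcongr
      _ = _ := by ring
  have hgs : ∑ i, g i ^ 2 ≤ s ^ 2 := Finset.sum_sq_le_sq_sum_of_nonneg (fun i _ => g0 i)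
  set a := s / n with ha
  set h : Fin n → ℝ := fun i => g i - a with hh
  have hsum : ∑ i, h i = 0 := by
    simp only [hh, Finset.sum_sub_distrib]
    simp [ha, ← hs]; field_simp; simp
  have hh2 : ∑ i, h i ^ 2 ≤ s ^ 2 := by
    have : ∑ i, h i ^ 2 = ∑ i, g i ^ 2 - s ^ 2 / n := by
      simp only [hh, sub_sq, Finset.sum_add_distrib, Finset.sum_sub_distrib, ← Finset.sum_mul,
        ← Finset.mul_sum, ← hs]
      simp [ha]; field_simp; ring
    rw [this]
    have : 0 ≤ s ^ 2 / n := by positivity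
    linarith
  have hgh : g = fun i => h i + a := by ext i; simp [hh]
  have hit := aux_iter_add G hG.1 h a (2 * m) t
  rw [← hgh] at hit
  rw [hit]
  obtain ⟨-, hp⟩ := aux_pow_s5 G hn hG hlam0 h hsum (2 * m)
  have hpt : ((Matrix.mulVec (G.adjMatrix ℝ) ·)^[2 * m] h) t ≤ lam ^ (2 * m) * s := by
    apply (abs_le_of_sq_le_sq' _ (by positivity)).2
    refine (Finset.single_le_sum (f := fun i => (((Matrix.mulVec (G.adjMatrix ℝ) ·)^[2 * m] h) i) ^ 2)
      (fun i _ => sq_nonneg _) (Finset.mem_univ t)).trans (hp.trans ?_)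
    rw [mul_pow]; gcongr
  have hlog : (n:ℝ) * lam ^ m ≤ d ^ m := by
    have h2 : 2 ≤ d / lam := by rw [le_div_iff₀ hlam0]; linarith
    have hl : 0 < Real.log (d / lam) := Real.log_pos (by linarith)
    rw [div_le_iff₀ hl, ← Real.log_pow, Real.log_le_log_iff hn' (by positivity), div_pow,
      le_div_iff₀ (by positivity)] at hmlog
    exact hmlog
  have hlog2 : lam ^ (2 * m) ≤ d ^ (2 * m) / n ^ 2 := by
    rw [le_div_iff₀ (by positivity)]
    calc lam ^ (2 * m) * (n:ℝ) ^ 2 = ((n:ℝ) * lam ^ m) ^ 2 := by rw [mul_comm 2 m, pow_mul]; ring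
      _ ≤ ((d:ℝ) ^ m) ^ 2 := by gcongr
      _ = _ := by rw [← pow_mul, mul_comm m 2]
  have e1 : (1 - (S.card:ℝ) / (2 * n)) ^ m ≤ Real.exp (-((m : ℝ) * k) / (2 * n)) := by
    have : 1 - (S.card:ℝ) / (2 * n) ≤ Real.exp (-(k / (2 * n))) := by
      have := Real.add_one_le_exp (-((k:ℝ) / (2 * n)))
      rw [hS]; linarith
    calc _ ≤ (Real.exp (-((k:ℝ) / (2 * n)))) ^ m := pow_le_pow_left₀ (by linarith) this m
      _ = _ := by rw [← Real.exp_nat_mul]; congr 1; ring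
  have e2 : 1 + 1 / (n:ℝ) ≤ Real.exp (1 / n) := by
    have := Real.add_one_le_exp (1 / (n:ℝ)); linarith
  calc _ ≤ d ^ (2 * m) / n ^ 2 * s + d ^ (2 * m) * a := by
        gcongr
        exact hpt.trans (by gcongr)
    _ = d ^ (2 * m) * (1 + 1 / n) / n * s := by rw [ha]; field_simp; ring
    _ ≤ d ^ (2 * m) * (1 + 1 / n) / n * (n * K ^ m) := by gcongr
    _ = d ^ (3 * m) * ((1 - (S.card:ℝ) / (2 * n)) ^ m * (1 + 1 / n)) := by
        rw [hKdef, mul_pow, show 3 * m = 2 * m + m by ring, pow_add]; field_simp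
    _ ≤ _ := by
        rw [Real.exp_add]; gcongr
end

section
/- Let G be an (n,d,λ)-graph with 0 < λ ≤ d/2, and let W be a set of vertices with |W| = n − k for some k ≥ 0. Then for every positive integer m, the number of walks of length m in G all of whose m+1 vertices lie in W is at most n·d^m·(1 − k/(2n))^m, which is at most n·d^m·exp(−m·k/(2n)). -/
open Matrix in
lemma psd_aux {n : ℕ} (M : Matrix (Fin n) (Fin n) ℝ) (hM : Mᵀ = M)
    (h : ∀ (μ : ℝ) (v : Fin n → ℝ), v ≠ 0 → M *ᵥ v = μ • v → 0 ≤ μ) (x : Fin n → ℝ) :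
    0 ≤ x ⬝ᵥ (M *ᵥ x) := by
  have hH : M.IsHermitian := by
    rw [Matrix.IsHermitian, conjTranspose_eq_transpose_of_trivial, hM]
  have hP : M.PosSemidef := by
    rw [hH.posSemidef_iff_eigenvalues_nonneg]
    intro i
    refine h _ _ ?_ (hH.mulVec_eigenvectorBasis i)
    intro h0
    apply hH.eigenvectorBasis.orthonormal.ne_zero i
    ext j
    exact congrFun h0 j
  simpa using hP.dotProduct_mulVec_nonneg x

open Matrix in
lemma norm_aux {n : ℕ} (B : Matrix (Fin n) (Fin n) ℝ) (hB : Bᵀ = B) (θ : ℝ) (hθ : 0 < θ)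
    (h1 : ∀ x : Fin n → ℝ, x ⬝ᵥ (B *ᵥ x) ≤ θ * (x ⬝ᵥ x))
    (h2 : ∀ x : Fin n → ℝ, -(θ * (x ⬝ᵥ x)) ≤ x ⬝ᵥ (B *ᵥ x)) (x : Fin n → ℝ) :
    (B *ᵥ x) ⬝ᵥ (B *ᵥ x) ≤ θ ^ 2 * (x ⬝ᵥ x) := by
  have ha := h2 (θ • x - B *ᵥ x)
  have hb := h1 (θ • x + B *ᵥ x)
  have hs : x ⬝ᵥ (B *ᵥ (B *ᵥ x)) = (B *ᵥ x) ⬝ᵥ (B *ᵥ x) := by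
    rw [dotProduct_mulVec x B, ← mulVec_transpose, hB]
  have hc : (B *ᵥ x) ⬝ᵥ x = x ⬝ᵥ (B *ᵥ x) := dotProduct_comm _ _
  simp only [mulVec_add, mulVec_sub, mulVec_smul, add_dotProduct, sub_dotProduct, dotProduct_add,
    dotProduct_sub, smul_dotProduct, dotProduct_smul, smul_eq_mul, hs, hc] at ha hb
  have : 0 ≤ 2 * θ * (θ ^ 2 * (x ⬝ᵥ x) - (B *ᵥ x) ⬝ᵥ (B *ᵥ x)) := by nlinarith
  have := nonneg_of_mul_nonneg_right this (by positivity)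
  linarith

open Matrix in
lemma sum_adj {n d : ℕ} (G : SimpleGraph (Fin n)) [DecidableRel G.Adj]
    (hG : G.IsRegularOfDegree d) (v : Fin n → ℝ) :
    ∑ i, (G.adjMatrix ℝ *ᵥ v) i = d * ∑ i, v i := by
  have h : ∑ i, (G.adjMatrix ℝ *ᵥ v) i = (fun _ => (1:ℝ)) ⬝ᵥ (G.adjMatrix ℝ *ᵥ v) := by
    simp [dotProduct]
  rw [h, dotProduct_mulVec, ← mulVec_transpose, SimpleGraph.transpose_adjMatrix]
  simp only [dotProduct, Finset.mul_sum]
  refine Finset.sum_congr rfl fun i _ => ?_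
  have := SimpleGraph.adjMatrix_mulVec_const_apply_of_regular (G := G) (a := (1:ℝ)) hG (v := i)
  rw [mul_one] at this
  rw [← this]; rfl

open Matrix in
lemma quad_lower {n d : ℕ} {lam : ℝ} (G : SimpleGraph (Fin n)) [DecidableRel G.Adj]
    (hG : IsNDLGraph n d lam G) (hl : 0 < lam) (x : Fin n → ℝ) :
    -(lam * (x ⬝ᵥ x)) ≤ x ⬝ᵥ (G.adjMatrix ℝ *ᵥ x) := by
  have := psd_aux (G.adjMatrix ℝ + lam • (1 : Matrix (Fin n) (Fin n) ℝ)) (by simp) ?_ x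
  · simp only [add_mulVec, smul_mulVec, one_mulVec, dotProduct_add, dotProduct_smul,
      smul_eq_mul] at this
    linarith
  · intro μ v hv h
    simp only [add_mulVec, smul_mulVec, one_mulVec] at h
    have hA : G.adjMatrix ℝ *ᵥ v = (μ - lam) • v := by rw [sub_smul, ← h]; simp
    have hs := sum_adj G hG.1 v
    rw [hA] at hs
    simp only [Pi.smul_apply, smul_eq_mul, ← Finset.mul_sum] at hs
    by_cases h0 : ∑ i, v i = 0
    · have := hG.2 _ v hv hA h0
      linarith [(abs_le.1 this).1]
    · have := mul_right_cancel₀ h0 hs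
      have : (0:ℝ) ≤ d := by positivity
      linarith

open Matrix in
lemma quad_upper {n d : ℕ} {lam : ℝ} (hn : 0 < n) (G : SimpleGraph (Fin n)) [DecidableRel G.Adj]
    (hG : IsNDLGraph n d lam G) (x : Fin n → ℝ) :
    x ⬝ᵥ (G.adjMatrix ℝ *ᵥ x) ≤ lam * (x ⬝ᵥ x) + (d - lam) / n * (∑ i, x i) ^ 2 := by
  have hn' : (n : ℝ) ≠ 0 := by positivity
  have hJ : ∀ v : Fin n → ℝ, (Matrix.of fun _ _ => (1:ℝ)) *ᵥ v = fun _ : Fin n => ∑ i, v i := by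
    intro v; ext i; simp [mulVec, dotProduct]
  have hJT : (Matrix.of fun (_ _ : Fin n) => (1:ℝ))ᵀ = Matrix.of fun _ _ => 1 := by
    ext; simp
  have := psd_aux (lam • (1 : Matrix (Fin n) (Fin n) ℝ) +
    ((d - lam) / n) • (Matrix.of fun _ _ => (1:ℝ)) - G.adjMatrix ℝ) (by
      rw [transpose_sub, transpose_add, transpose_smul, transpose_smul, hJT]; simp) ?_ x
  · simp only [add_mulVec, sub_mulVec, smul_mulVec, one_mulVec, dotProduct_add, dotProduct_sub,
      dotProduct_smul, smul_eq_mul, hJ] at this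
    have e : x ⬝ᵥ (fun _ => ∑ i, x i) = (∑ i, x i) ^ 2 := by
      simp [dotProduct, ← Finset.sum_mul, sq]
    rw [e] at this
    linarith
  · intro μ v hv h
    simp only [add_mulVec, sub_mulVec, smul_mulVec, one_mulVec, hJ] at h
    have hs := sum_adj G hG.1 v
    have h' : ∀ i, (G.adjMatrix ℝ *ᵥ v) i = (lam - μ) * v i + (d - lam) / n * ∑ i, v i := by
      intro i
      have := congrFun h i
      simp only [Pi.sub_apply, Pi.add_apply, Pi.smul_apply, smul_eq_mul] at this
      linarith
    simp only [h', Finset.sum_add_distrib, ← Finset.mul_sum, Finset.sum_const, Finset.card_univ,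
      Fintype.card_fin, nsmul_eq_mul] at hs
    have hz : μ * ∑ i, v i = 0 := by
      field_simp at hs
      linarith
    rcases mul_eq_zero.1 hz with h0 | h0
    · exact h0.ge
    · have := hG.2 (lam - μ) v hv (by ext i; rw [h', h0]; simp) h0
      linarith [(abs_le.1 this).2]

/-- restricted adjacency matrix -/
def resMat {n : ℕ} (G : SimpleGraph (Fin n)) [DecidableRel G.Adj] (W : Finset (Fin n)) :
    Matrix (Fin n) (Fin n) ℝ :=
  Matrix.of fun u v => if u ∈ W ∧ v ∈ W ∧ G.Adj u v then 1 else 0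

open Matrix in
lemma resMat_quad {n : ℕ} (G : SimpleGraph (Fin n)) [DecidableRel G.Adj] (W : Finset (Fin n))
    (x : Fin n → ℝ) : x ⬝ᵥ (resMat G W *ᵥ x) =
      (fun i => if i ∈ W then x i else 0) ⬝ᵥ
        (G.adjMatrix ℝ *ᵥ (fun i => if i ∈ W then x i else 0)) := by
  simp only [dotProduct, mulVec, Finset.mul_sum]
  refine Finset.sum_congr rfl fun i _ => Finset.sum_congr rfl fun j _ => ?_
  simp only [resMat, Matrix.of_apply, SimpleGraph.adjMatrix_apply]
  by_cases h1 : i ∈ W <;> by_cases h2 : j ∈ W <;> simp [h1, h2]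

open Classical Matrix in
lemma walk_sum {n : ℕ} (G : SimpleGraph (Fin n)) [DecidableRel G.Adj] (W : Finset (Fin n))
    (m : ℕ) : ∀ g : Fin n → ℝ,
    ∑ w : Fin (m + 1) → Fin n, (if IsWalkSeq G m w ∧ ∀ i, w i ∈ W then g (w 0) else 0) =
      g ⬝ᵥ ((fun v => resMat G W *ᵥ v)^[m] (fun i => if i ∈ W then 1 else 0)) := by
  induction m with
  | zero =>
    intro g
    rw [← (Equiv.funUnique (Fin 1) (Fin n)).symm.sum_comp]
    simp [IsWalkSeq, dotProduct]
  | succ m ih =>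
    intro g
    rw [Function.iterate_succ_apply', dotProduct_mulVec, ← ih]
    rw [← (Fin.consEquiv (fun _ => Fin n)).sum_comp, Fintype.sum_prod_type, Finset.sum_comm]
    refine Finset.sum_congr rfl fun w _ => ?_
    change (∑ v, if IsWalkSeq G (m+1) (Fin.cons v w : Fin (m+2) → Fin n) ∧
        ∀ i, (Fin.cons v w : Fin (m+2) → Fin n) i ∈ W then g v else 0) = _
    have key : ∀ v : Fin n, (IsWalkSeq G (m+1) (Fin.cons v w : Fin (m+2) → Fin n) ∧
        ∀ i, (Fin.cons v w : Fin (m+2) → Fin n) i ∈ W) ↔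
        (IsWalkSeq G m w ∧ ∀ i, w i ∈ W) ∧ v ∈ W ∧ w 0 ∈ W ∧ G.Adj v (w 0) := by
      intro v
      simp only [IsWalkSeq, Fin.forall_fin_succ (n := m+1), Fin.forall_fin_succ (n := m),
        Fin.castSucc_zero, Fin.cons_zero, Fin.cons_succ, ← Fin.succ_castSucc]
      tauto
    simp only [key]
    by_cases hw : IsWalkSeq G m w ∧ ∀ i, w i ∈ W
    · rw [if_pos hw]
      simp only [vecMul, dotProduct, resMat, Matrix.of_apply]
      refine Finset.sum_congr rfl fun v _ => ?_
      by_cases hv : v ∈ W ∧ w 0 ∈ W ∧ G.Adj v (w 0)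
      · rw [if_pos ⟨hw, hv⟩, if_pos hv, mul_one]
      · rw [if_neg (fun h => hv h.2), if_neg hv, mul_zero]
    · rw [if_neg hw]
      simp [hw]

/-- Let `G` be an `(n,d,λ)`-graph with `0 < λ ≤ d/2` and let `W` be a set of `n − k`
vertices, `k ≥ 0`.  For every positive integer `m`, the number of walks of length `m` in `G`
all of whose `m+1` vertices lie in `W` is at most `n·d^m·(1 − k/(2n))^m`, which in turn is
at most `n·d^m·exp(−m·k/(2n))`. -/
theorem stmt7 (n d : ℕ) (lam : ℝ) (G : SimpleGraph (Fin n)) [DecidableRel G.Adj]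
    (hG : IsNDLGraph n d lam G) (hlam0 : 0 < lam) (hlamd : lam ≤ d / 2)
    (W : Finset (Fin n)) (k : ℕ) (hkn : k ≤ n) (hW : W.card = n - k)
    (m : ℕ) (hm : 0 < m) :
    (Nat.card {w : Fin (m + 1) → Fin n //
        IsWalkSeq G m w ∧ ∀ i, w i ∈ W} : ℝ)
      ≤ (n : ℝ) * (d : ℝ) ^ m * (1 - (k : ℝ) / (2 * n)) ^ m ∧
    (n : ℝ) * (d : ℝ) ^ m * (1 - (k : ℝ) / (2 * n)) ^ m
      ≤ (n : ℝ) * (d : ℝ) ^ m * Real.exp (-((m : ℝ) * k) / (2 * n)) := by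
  classical
  rcases Nat.eq_zero_or_pos n with rfl | hn
  · simp
  have hn' : (0:ℝ) < n := by exact_mod_cast hn
  have hk' : (k:ℝ) ≤ n := by exact_mod_cast hkn
  have hd : (0:ℝ) < d := by linarith
  have hk2 : (k:ℝ) / (2 * n) ≤ 1 / 2 := by
    rw [div_le_div_iff₀ (by positivity) (by norm_num)]; linarith
  have hWc : (W.card : ℝ) = n - k := by rw [hW, Nat.cast_sub hkn]
  constructor
  · rw [mul_assoc, ← mul_pow]
    set θ : ℝ := d * (1 - (k : ℝ) / (2 * n)) with hθ
    have hθ2 : d / 2 ≤ θ := by rw [hθ]; nlinarith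
    have hθ0 : 0 < θ := by linarith
    have hpr : ∀ x : Fin n → ℝ, dotProduct (fun i => if i ∈ W then x i else 0)
        (fun i => if i ∈ W then x i else 0) ≤ dotProduct x x := by
      intro x
      refine Finset.sum_le_sum fun i _ => ?_
      by_cases h : i ∈ W
      · simp [h]
      · simp [h, mul_self_nonneg]
    have hnb := norm_aux (resMat G W) (by
        ext i j
        simp only [resMat, Matrix.transpose_apply, Matrix.of_apply, G.adj_comm i j]
        congr 1
        simp only [eq_iff_iff]; tauto) θ hθ0 (by
      intro x
      rw [resMat_quad]
      refine (quad_upper hn G hG _).trans ?_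
      have hp := hpr x
      have hcs : (∑ i, if i ∈ W then x i else 0) ^ 2 ≤ (n - k) *
          dotProduct (fun i => if i ∈ W then x i else 0)
            (fun i => if i ∈ W then x i else 0) := by
        rw [← hWc]
        have := sq_sum_le_card_mul_sum_sq (s := W) (f := x)
        simpa [dotProduct, sq, Finset.sum_ite_mem] using this
      have hq : 0 ≤ dotProduct (fun i => if i ∈ W then x i else 0)
            (fun i => if i ∈ W then x i else 0) :=
        Finset.sum_nonneg fun i _ => mul_self_nonneg _
      generalize dotProduct (fun i => if i ∈ W then x i else 0)
            (fun i => if i ∈ W then x i else 0) = q at *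
      have hc : 0 ≤ (d - lam) / n := div_nonneg (by linarith) hn'.le
      have h1 := mul_le_mul_of_nonneg_left hcs hc
      have h2 : lam + (d - lam) / n * (n - k) ≤ θ := by
        have e : lam + (d - lam) / n * (n - k) = θ - (d / 2 - lam) * (k / n) := by
          rw [hθ]; field_simp; ring
        rw [e]
        have : 0 ≤ (d / 2 - lam) * (k / n) := mul_nonneg (by linarith) (by positivity)
        linarith
      have h3 := mul_le_mul_of_nonneg_right h2 hq
      have h4 := mul_le_mul_of_nonneg_left hp hθ0.le
      linarith) (by
      intro x
      rw [resMat_quad]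
      refine le_trans ?_ (quad_lower G hG hlam0 _)
      have hp := hpr x
      have hq : 0 ≤ dotProduct x x := Finset.sum_nonneg fun i _ => mul_self_nonneg _
      have h4 := mul_le_mul_of_nonneg_left hp hlam0.le
      have h5 : lam * dotProduct x x ≤ θ * dotProduct x x :=
        mul_le_mul_of_nonneg_right (by linarith) hq
      linarith)
    have hs := walk_sum G W m (fun _ => 1)
    have hcard : (Nat.card {w : Fin (m + 1) → Fin n //
        IsWalkSeq G m w ∧ ∀ i, w i ∈ W} : ℝ) =
        ∑ w : Fin (m + 1) → Fin n, (if IsWalkSeq G m w ∧ ∀ i, w i ∈ W then (1:ℝ) else 0) := by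
      rw [Nat.card_eq_fintype_card, Fintype.card_subtype]
      simp
    rw [hcard, hs]
    have hit : ∀ m : ℕ, dotProduct
        ((fun v => (resMat G W).mulVec v)^[m] (fun i => if i ∈ W then 1 else 0))
        ((fun v => (resMat G W).mulVec v)^[m] (fun i => if i ∈ W then 1 else 0))
        ≤ (θ ^ m) ^ 2 * n := by
      intro m
      induction m with
      | zero =>
        simp only [Function.iterate_zero, id]
        have := hpr (fun _ => 1)
        simpa [dotProduct] using this
      | succ m ih =>
        rw [Function.iterate_succ_apply']
        refine (hnb _).trans ?_
        have := mul_le_mul_of_nonneg_left ih (sq_nonneg θ)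
        calc _ ≤ _ := this
          _ = _ := by ring
    have h6 := hit m
    generalize ((fun v => (resMat G W).mulVec v)^[m] (fun i => if i ∈ W then 1 else 0)) = y at *
    have h7 := sq_sum_le_card_mul_sum_sq (s := Finset.univ) (f := y)
    have e : dotProduct (fun _ => (1:ℝ)) y = ∑ i, y i := by simp [dotProduct]
    have e2 : dotProduct y y = ∑ i, y i ^ 2 := by simp [dotProduct, sq]
    rw [e]
    rw [e2] at h6
    simp only [Finset.card_univ, Fintype.card_fin] at h7
    apply le_of_sq_le_sq _ (by positivity)
    nlinarith
  · refine mul_le_mul_of_nonneg_left ?_ (by positivity)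
    have : Real.exp (-((m : ℝ) * k) / (2 * n)) = Real.exp (-(k / (2 * n))) ^ m := by
      rw [← Real.exp_nat_mul]; congr 1; ring
    rw [this]
    refine pow_le_pow_left₀ (by linarith) ?_ _
    have := Real.add_one_le_exp (-((k:ℝ) / (2 * n)))
    linarith
end

section
/- Let n ≥ 2 and 1.5·ln(n)/n ≤ p < 1, and let G be an Erdős–Rényi random graph G(n,p) on vertex set {1,…,n} with s = 1 and t = n. Then for every deterministic adaptive node-incidence query algorithm making at most q queries, the probability that its output is a valid s-t path in G is at most p + p²·n·(q+1)² + q/√n. Consequently, any (possibly randomized) algorithm making o(1/(p√n)) node-incidence queries outputs a valid s-t path with probability at most p + o(1). -/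
/-- The potential edges of a graph on vertex set `Fin n`: unordered pairs of distinct
vertices. -/
abbrev EdgeSlot (n : ℕ) := {e : Sym2 (Fin n) // ¬e.IsDiag}

/-- A graph is encoded as `g : EdgeSlot n → Bool`, indicating which edges are present.
`gAdj g u v` says that `u` and `v` are joined by an edge of `g`. -/
def gAdj {n : ℕ} (g : EdgeSlot n → Bool) (u v : Fin n) : Prop :=
  ∃ e : EdgeSlot n, e.1 = s(u, v) ∧ g e = true

/-- The neighborhood of `v` in the graph `g` (determining the set of edges incident
to `v`). -/
noncomputable def nbhd {n : ℕ} (g : EdgeSlot n → Bool) (v : Fin n) : Finset (Fin n) := by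
  classical exact Finset.univ.filter fun u => gAdj g v u

/-- The probability of the graph `g` under the Erdős–Rényi distribution `G(n,p)`: every
one of the `n(n−1)/2` possible edges is present independently with probability `p`. -/
noncomputable def erWeight {n : ℕ} (p : ℝ) (g : EdgeSlot n → Bool) : ℝ :=
  ∏ e : EdgeSlot n, if g e then p else 1 - p

/-- The probability of the event `E` under the Erdős–Rényi distribution `G(n,p)`. -/
noncomputable def erProb (n : ℕ) (p : ℝ) (E : (EdgeSlot n → Bool) → Prop) : ℝ := by
  classical exact ∑ g : EdgeSlot n → Bool, if E g then erWeight p g else 0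

/-- A deterministic adaptive node-incidence query algorithm: `nextQuery` selects the next
vertex to query from the transcript so far (the list of queried vertices together with the
answers, each answer being the neighborhood of the queried vertex, i.e. the set of edges
incident to it), and `output` produces a vertex sequence from the full transcript. -/
structure ERAlgo (n : ℕ) where
  nextQuery : List (Fin n × Finset (Fin n)) → Fin n
  output : List (Fin n × Finset (Fin n)) → List (Fin n)

/-- The transcript of the first `q` queries of algorithm `A` run on the graph `g`. -/
noncomputable def erRun {n : ℕ} (A : ERAlgo n) (g : EdgeSlot n → Bool) : ℕ → List (Fin n × Finset (Fin n))
  | 0 => []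
  | q + 1 =>
      let h := erRun A g q
      h ++ [(A.nextQuery h, nbhd g (A.nextQuery h))]

/-- `L` is a valid `s`-`t` path in the graph `g`: it starts at `s`, ends at `t`, and every
pair of consecutive vertices is joined by an edge of `g`. -/
def IsValidPath {n : ℕ} (g : EdgeSlot n → Bool) (s t : Fin n) (L : List (Fin n)) : Prop :=
  L.head? = some s ∧ L.getLast? = some t ∧ L.Chain' (gAdj g)

/-- `u` and `v` are joined by an edge discovered in the transcript `h`. -/
def discAdj {n : ℕ} (h : List (Fin n × Finset (Fin n))) (u v : Fin n) : Prop :=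
  ∃ e ∈ h, (e.1 = u ∧ v ∈ e.2) ∨ (e.1 = v ∧ u ∈ e.2)

section helpers
open Finset

open Classical in
theorem erProb_eq (n : ℕ) (p : ℝ) (E : (EdgeSlot n → Bool) → Prop) :
    erProb n p E = ∑ g : EdgeSlot n → Bool, if E g then erWeight p g else 0 := by
  unfold erProb
  rfl

theorem erWeight_nonneg {n : ℕ} {p : ℝ} (h0 : 0 ≤ p) (h1 : p ≤ 1) (g : EdgeSlot n → Bool) :
    0 ≤ erWeight p g := by
  unfold erWeight
  apply Finset.prod_nonneg
  intro e _
  split_ifs <;> linarith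

theorem erWeight_sum (n : ℕ) (p : ℝ) : ∑ g : EdgeSlot n → Bool, erWeight p g = 1 := by
  classical
  unfold erWeight
  have := Finset.prod_univ_sum (fun _ : EdgeSlot n => (Finset.univ : Finset Bool))
    (fun _ b => if b then p else 1 - p)
  rw [Fintype.piFinset_univ] at this
  rw [← this]
  simp

/-- If the events cover, union bound. -/
theorem erProb_union {n : ℕ} {p : ℝ} (h0 : 0 ≤ p) (h1 : p ≤ 1) {ι : Type*} (s : Finset ι)
    (E : (EdgeSlot n → Bool) → Prop) (F : ι → (EdgeSlot n → Bool) → Prop)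
    (h : ∀ g, E g → ∃ i ∈ s, F i g) : erProb n p E ≤ ∑ i ∈ s, erProb n p (F i) := by
  classical
  simp only [erProb_eq]
  rw [Finset.sum_comm]
  apply Finset.sum_le_sum
  intro g _
  have hw := erWeight_nonneg h0 h1 g
  have hnn : ∀ i ∈ s, 0 ≤ if F i g then erWeight p g else 0 := by
    intro i _
    split_ifs <;> simp [hw]
  split_ifs with hE
  · obtain ⟨i, hi, hF⟩ := h g hE
    refine le_trans ?_ (Finset.single_le_sum hnn hi)
    simp [hF]
  · exact Finset.sum_nonneg hnn

theorem erProb_disj {n : ℕ} {p : ℝ} (h0 : 0 ≤ p) (h1 : p ≤ 1) {ι : Type*} (s : Finset ι)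
    (E : (EdgeSlot n → Bool) → Prop) (F : ι → (EdgeSlot n → Bool) → Prop)
    (h : ∀ g, ∀ i ∈ s, F i g → E g) (hd : ∀ g, ∀ i ∈ s, ∀ j ∈ s, F i g → F j g → i = j) :
    ∑ i ∈ s, erProb n p (F i) ≤ erProb n p E := by
  classical
  simp only [erProb_eq]
  rw [Finset.sum_comm]
  apply Finset.sum_le_sum
  intro g _
  have hw := erWeight_nonneg h0 h1 g
  by_cases hex : ∃ i ∈ s, F i g
  · obtain ⟨i, hi, hF⟩ := hex
    rw [Finset.sum_eq_single_of_mem i hi, if_pos hF, if_pos (h g i hi hF)]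
    intro j hj hne
    rw [if_neg]
    intro hFj
    exact hne (hd g j hj i hi hFj hF)
  · push Not at hex
    rw [Finset.sum_eq_zero]
    · split_ifs <;> simp [hw]
    · intro i hi
      rw [if_neg (hex i hi)]

theorem erProb_mono {n : ℕ} {p : ℝ} (h0 : 0 ≤ p) (h1 : p ≤ 1)
    {E F : (EdgeSlot n → Bool) → Prop} (h : ∀ g, E g → F g) : erProb n p E ≤ erProb n p F := by
  have := erProb_union h0 h1 (Finset.univ : Finset Unit) E (fun _ => F)
    (fun g hg => ⟨(), by simp, h g hg⟩)
  simpa using this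

theorem erProb_le_one {n : ℕ} {p : ℝ} (h0 : 0 ≤ p) (h1 : p ≤ 1)
    (E : (EdgeSlot n → Bool) → Prop) : erProb n p E ≤ 1 := by
  refine (erProb_mono h0 h1 (F := fun _ => True) (fun _ _ => trivial)).trans ?_
  rw [erProb_eq]
  simp [erWeight_sum]

theorem erProb_or {n : ℕ} {p : ℝ} (h0 : 0 ≤ p) (h1 : p ≤ 1)
    (E F G : (EdgeSlot n → Bool) → Prop) (h : ∀ g, E g → F g ∨ G g) :
    erProb n p E ≤ erProb n p F + erProb n p G := by
  have := erProb_union h0 h1 (Finset.univ : Finset Bool) E (fun b => if b then F else G)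
    (fun g hg => by
      rcases h g hg with h | h
      · exact ⟨true, by simp, by simpa using h⟩
      · exact ⟨false, by simp, by simpa using h⟩)
  simpa using this

theorem erProb_edge {n : ℕ} {p : ℝ} (e : EdgeSlot n)
    (E : (EdgeSlot n → Bool) → Prop) (h : ∀ g b, E g → E (Function.update g e b)) :
    erProb n p (fun g => E g ∧ g e = true) = p * erProb n p E := by
  classical
  have hb : ∀ g b, E (Function.update g e b) ↔ E g := by
    intro g b
    refine ⟨fun h' => ?_, h g b⟩
    have := h _ (g e) h'
    simpa using this
  have hw : ∀ g : EdgeSlot n → Bool, ∀ b, erWeight p (Function.update g e b) =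
      (if b then p else 1 - p) * ∏ x ∈ Finset.univ.erase e, (if g x then p else 1 - p) := by
    intro g b
    unfold erWeight
    rw [← Finset.mul_prod_erase _ _ (Finset.mem_univ e)]
    simp only [Function.update_self]
    congr 1
    apply Finset.prod_congr rfl
    intro x hx
    rw [Function.update_of_ne (Finset.ne_of_mem_erase hx)]
  let fl : (EdgeSlot n → Bool) → (EdgeSlot n → Bool) := fun g => Function.update g e (!(g e))
  have hfl : Function.Involutive fl := by
    intro g
    simp [fl]
  have hsplit : erProb n p E = erProb n p (fun g => E g ∧ g e = true)
      + erProb n p (fun g => E g ∧ g e = false) := by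
    simp only [erProb_eq]
    rw [← Finset.sum_add_distrib]
    apply Finset.sum_congr rfl
    intro g _
    by_cases hE : E g <;> cases hg : g e <;> simp [hE]
  have hflip : (1 - p) * erProb n p (fun g => E g ∧ g e = true)
      = p * erProb n p (fun g => E g ∧ g e = false) := by
    simp only [erProb_eq]
    rw [Finset.mul_sum, Finset.mul_sum, ← Equiv.sum_comp (hfl.toPerm fl)]
    apply Finset.sum_congr rfl
    intro g _
    have h1 : (hfl.toPerm fl) g = Function.update g e (!(g e)) := rfl
    have h2 : erWeight p g = erWeight p (Function.update g e (g e)) := by simp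
    rw [h1, h2, hw, hw]
    simp only [hb, Function.update_self]
    by_cases hE : E g <;> cases hg : g e <;> simp [hE]
    ring
  rw [hsplit]
  linarith

/-- queried vertices -/
def qd {n : ℕ} (A : ERAlgo n) (g : EdgeSlot n → Bool) (k : ℕ) (u : Fin n) : Prop :=
  u ∈ (erRun A g k).map Prod.fst

noncomputable def vq {n : ℕ} (A : ERAlgo n) (g : EdgeSlot n → Bool) (k : ℕ) : Fin n :=
  A.nextQuery (erRun A g k)

theorem qd_succ {n : ℕ} (A : ERAlgo n) (g : EdgeSlot n → Bool) (k : ℕ) (u : Fin n) :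
    qd A g (k + 1) u ↔ qd A g k u ∨ u = vq A g k := by
  unfold qd vq
  rw [erRun]
  simp only [List.map_append, List.mem_append, List.map_cons, List.map_nil, List.mem_singleton]

theorem gAdj_symm {n : ℕ} {g : EdgeSlot n → Bool} {u v : Fin n} (h : gAdj g u v) :
    gAdj g v u := by
  obtain ⟨e, he, hg⟩ := h
  exact ⟨e, by rw [he, Sym2.eq_swap], hg⟩

theorem gAdj_ne {n : ℕ} {g : EdgeSlot n → Bool} {u v : Fin n} (h : gAdj g u v) :
    u ≠ v := by
  obtain ⟨e, he, hg⟩ := h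
  rintro rfl
  apply e.2
  rw [he]
  simp

theorem gAdj_iff {n : ℕ} {g : EdgeSlot n → Bool} {u v : Fin n} (e : EdgeSlot n)
    (he : e.1 = s(u, v)) : gAdj g u v ↔ g e = true := by
  constructor
  · rintro ⟨e', he', hg⟩
    have : e' = e := Subtype.ext (he'.trans he.symm)
    rwa [← this]
  · exact fun h => ⟨e, he, h⟩

theorem gAdj_update {n : ℕ} (g : EdgeSlot n → Bool) {u v w x : Fin n} (e : EdgeSlot n)
    (he : e.1 = s(u, v)) (b : Bool) (h1 : w ≠ u) (h2 : w ≠ v) :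
    gAdj (Function.update g e b) w x ↔ gAdj g w x := by
  unfold gAdj
  apply exists_congr
  intro e'
  apply and_congr_right
  intro he'
  rw [Function.update_of_ne]
  rintro rfl
  rw [he] at he'
  have : w ∈ s(u, v) := by rw [he']; simp
  simp at this
  tauto

theorem run_update {n : ℕ} (A : ERAlgo n) (g : EdgeSlot n → Bool) {u v : Fin n} (e : EdgeSlot n)
    (he : e.1 = s(u, v)) (b : Bool) (k : ℕ) (hu : ¬ qd A g k u) (hv : ¬ qd A g k v) :
    erRun A (Function.update g e b) k = erRun A g k := by
  induction k with
  | zero => rfl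
  | succ k ih =>
    rw [qd_succ] at hu hv
    push Not at hu hv
    have := ih hu.1 hv.1
    rw [erRun, erRun, this]
    have hn : nbhd (Function.update g e b) (A.nextQuery (erRun A g k))
        = nbhd g (A.nextQuery (erRun A g k)) := by
      unfold nbhd
      ext x
      simp only [Finset.mem_filter, Finset.mem_univ, true_and]
      exact gAdj_update g e he b (Ne.symm hu.2) (Ne.symm hv.2)
    simp only [hn]

/-- Fresh edges: for an event `φ` of the transcript. -/
theorem fresh_edge {n : ℕ} {p : ℝ} (h0 : 0 ≤ p) (h1 : p ≤ 1) (A : ERAlgo n) (k : ℕ)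
    (u v : Fin n) (E : (EdgeSlot n → Bool) → Prop)
    (hu : ∀ g, E g → ¬ qd A g k u) (hv : ∀ g, E g → ¬ qd A g k v)
    (h : ∀ g g', E g → erRun A g' k = erRun A g k →
      (∀ w x, w ≠ u → w ≠ v → (gAdj g' w x ↔ gAdj g w x)) → E g') :
    erProb n p (fun g => E g ∧ gAdj g u v) ≤ p * erProb n p E := by
  by_cases huv : u = v
  · subst huv
    have : erProb n p (fun g => E g ∧ gAdj g u u) = 0 := by
      rw [erProb_eq]
      apply Finset.sum_eq_zero
      intro g _
      rw [if_neg]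
      rintro ⟨-, h⟩
      exact gAdj_ne h rfl
    rw [this]
    apply mul_nonneg h0
    rw [erProb_eq]
    apply Finset.sum_nonneg
    intro g _
    have := erWeight_nonneg h0 h1 g
    split_ifs <;> simp [this]
  · let e : EdgeSlot n := ⟨s(u, v), by simpa using huv⟩
    have he : e.1 = s(u, v) := rfl
    simp only [gAdj_iff e he]
    apply le_of_eq
    apply erProb_edge
    intro g b hE
    exact h g _ hE (run_update A g e he b k (hu g hE) (hv g hE))
      (fun w x h1 h2 => gAdj_update g e he b h1 h2)

def marked {n : ℕ} (A : ERAlgo n) (g : EdgeSlot n → Bool) (k : ℕ) (u : Fin n) : Prop :=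
  ¬ qd A g k u ∧ ∃ w, qd A g k w ∧ gAdj g w u

theorem qd_first {n : ℕ} (A : ERAlgo n) (g : EdgeSlot n → Bool) (k : ℕ) (w : Fin n)
    (h : qd A g k w) : ∃ j < k, vq A g j = w ∧ ¬ qd A g j w := by
  induction k with
  | zero => simp [qd, erRun] at h
  | succ k ih =>
    by_cases hk : qd A g k w
    · obtain ⟨j, hj, h⟩ := ih hk
      exact ⟨j, by omega, h⟩
    · rw [qd_succ] at h
      exact ⟨k, by omega, (h.resolve_left hk).symm, hk⟩

theorem qd_mono {n : ℕ} (A : ERAlgo n) (g : EdgeSlot n → Bool) {j k : ℕ} (hjk : j ≤ k) (w : Fin n)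
    (h : qd A g j w) : qd A g k w := by
  induction k, hjk using Nat.le_induction with
  | base => exact h
  | succ k _ ih => rw [qd_succ]; exact Or.inl ih

theorem sum_vq {n : ℕ} {p : ℝ} (h0 : 0 ≤ p) (h1 : p ≤ 1) (A : ERAlgo n) (k : ℕ)
    (E : (EdgeSlot n → Bool) → Prop) (F : Fin n → (EdgeSlot n → Bool) → Prop)
    (h : ∀ v g, F v g → vq A g k = v ∧ E g) :
    ∑ v, erProb n p (F v) ≤ erProb n p E := by
  apply erProb_disj h0 h1
  · intro g v _ hF
    exact (h v g hF).2
  · intro g i _ j _ hi hj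
    rw [← (h i g hi).1, ← (h j g hj).1]

theorem marked_prob {n : ℕ} {p : ℝ} (h0 : 0 ≤ p) (h1 : p ≤ 1) (A : ERAlgo n) (k : ℕ) (u : Fin n) :
    erProb n p (fun g => marked A g k u) ≤ k * p := by
  have hstep : ∀ j, erProb n p (fun g => ¬ qd A g j u ∧ ¬ qd A g j (vq A g j) ∧
      gAdj g (vq A g j) u) ≤ p := by
    intro j
    let F : Fin n → (EdgeSlot n → Bool) → Prop := fun v g =>
      vq A g j = v ∧ ¬ qd A g j u ∧ ¬ qd A g j v
    calc _ ≤ ∑ v, erProb n p (fun g => F v g ∧ gAdj g v u) := by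
            apply erProb_union h0 h1
            rintro g ⟨h1, h2, h3⟩
            exact ⟨vq A g j, Finset.mem_univ _, ⟨rfl, h1, h2⟩, h3⟩
      _ ≤ ∑ v, p * erProb n p (F v) := by
            apply Finset.sum_le_sum
            intro v _
            apply fresh_edge h0 h1 A j
            · exact fun g h => h.2.2
            · exact fun g h => h.2.1
            · intro g g' h hr _
              simpa only [F, qd, vq, hr] using h
      _ ≤ p * 1 := by
            rw [← Finset.mul_sum]
            apply mul_le_mul_of_nonneg_left _ h0
            exact (sum_vq h0 h1 A j (fun _ => True) F (fun v g h => ⟨h.1, trivial⟩)).trans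
              (erProb_le_one h0 h1 _)
      _ = p := mul_one p
  calc _ ≤ ∑ j ∈ Finset.range k, erProb n p (fun g => ¬ qd A g j u ∧ ¬ qd A g j (vq A g j) ∧
      gAdj g (vq A g j) u) := by
            apply erProb_union h0 h1
            rintro g ⟨hu, w, hw, hg⟩
            obtain ⟨j, hj, hv, hjw⟩ := qd_first A g k w hw
            refine ⟨j, Finset.mem_range.2 hj, ?_, ?_, ?_⟩
            · exact fun h => hu (qd_mono A g hj.le u h)
            · rwa [hv]
            · rwa [hv]
    _ ≤ ∑ j ∈ Finset.range k, p := Finset.sum_le_sum (fun j _ => hstep j)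
    _ = k * p := by simp

def bad {n : ℕ} (s t : Fin n) (A : ERAlgo n) (g : EdgeSlot n → Bool) (k : ℕ) : Prop :=
  ∃ u, (¬ qd A g k u ∧ ¬ qd A g k (vq A g k) ∧ (u = s ∨ u = t ∨ marked A g k u)) ∧
    gAdj g (vq A g k) u

theorem bad_prob {n : ℕ} {p : ℝ} (h0 : 0 ≤ p) (h1 : p ≤ 1) (s t : Fin n) (A : ERAlgo n) (k : ℕ) :
    erProb n p (fun g => bad s t A g k) ≤ p * (2 + n * (k * p)) := by
  let M : Fin n → (EdgeSlot n → Bool) → Prop := fun u g => u = s ∨ u = t ∨ marked A g k u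
  let F : Fin n → Fin n → (EdgeSlot n → Bool) → Prop := fun u v g =>
    vq A g k = v ∧ ¬ qd A g k u ∧ ¬ qd A g k v ∧ M u g
  have hM : ∀ u, erProb n p (M u) ≤ (if u = s then 1 else 0) + (if u = t then 1 else 0) + k * p := by
    intro u
    have hk : 0 ≤ k * p := by positivity
    by_cases hs : u = s
    · have := erProb_le_one h0 h1 (M u)
      rw [if_pos hs]
      split_ifs <;> linarith
    by_cases ht : u = t
    · have := erProb_le_one h0 h1 (M u)
      rw [if_pos ht]
      split_ifs <;> linarith
    rw [if_neg hs, if_neg ht]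
    have := marked_prob h0 h1 A k u
    simpa [M, hs, ht] using this
  calc _ ≤ ∑ u, erProb n p (fun g => ∃ v, F u v g ∧ gAdj g v u) := by
          apply erProb_union h0 h1
          rintro g ⟨u, ⟨h1, h2, h3⟩, h4⟩
          exact ⟨u, Finset.mem_univ _, vq A g k, ⟨rfl, h1, h2, h3⟩, h4⟩
    _ ≤ ∑ u, ∑ v, erProb n p (fun g => F u v g ∧ gAdj g v u) := by
          apply Finset.sum_le_sum
          intro u _
          apply erProb_union h0 h1
          rintro g ⟨v, h⟩
          exact ⟨v, Finset.mem_univ _, h⟩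
    _ ≤ ∑ u, ∑ v, p * erProb n p (F u v) := by
          apply Finset.sum_le_sum
          intro u _
          apply Finset.sum_le_sum
          intro v _
          apply fresh_edge h0 h1 A k
          · exact fun g h => h.2.2.1
          · exact fun g h => h.2.1
          · rintro g g' ⟨ha, hb, hc, hd⟩ hr hadj
            refine ⟨?_, ?_, ?_, ?_⟩
            · simpa only [vq, hr] using ha
            · simpa only [qd, hr] using hb
            · simpa only [qd, hr] using hc
            · rcases hd with hd | hd | ⟨hd, w, hw, hg⟩
              · exact Or.inl hd
              · exact Or.inr (Or.inl hd)
              · refine Or.inr (Or.inr ⟨by simpa only [qd, hr] using hd, w,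
                  by simpa only [qd, hr] using hw, ?_⟩)
                rw [hadj]
                · exact hg
                · rintro rfl
                  exact hc hw
                · rintro rfl
                  exact hb hw
    _ ≤ ∑ u, p * ((if u = s then 1 else 0) + (if u = t then 1 else 0) + k * p) := by
          apply Finset.sum_le_sum
          intro u _
          rw [← Finset.mul_sum]
          apply mul_le_mul_of_nonneg_left _ h0
          exact (sum_vq h0 h1 A k (M u) (F u) (fun v g h => ⟨h.1, h.2.2.2⟩)).trans (hM u)
    _ = p * (2 + n * (k * p)) := by
          rw [← Finset.mul_sum, Finset.sum_add_distrib, Finset.sum_add_distrib]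
          simp
          left
          norm_num

/-- edges discovered -/
def dAdj {n : ℕ} (A : ERAlgo n) (g : EdgeSlot n → Bool) (k : ℕ) (a b : Fin n) : Prop :=
  gAdj g a b ∧ (qd A g k a ∨ qd A g k b)

theorem no_bad {n : ℕ} (s t : Fin n) (hst : s ≠ t) (A : ERAlgo n) (g : EdgeSlot n → Bool) (k : ℕ)
    (h : ∀ j < k, ¬ bad s t A g j) :
    ∃ S : Set (Fin n), s ∈ S ∧ t ∉ S ∧ ∀ a b, dAdj A g k a b → (a ∈ S ↔ b ∈ S) := by
  induction k with
  | zero => exact ⟨{s}, rfl, fun h => hst h.symm, fun a b h => by simp [dAdj, qd, erRun] at h⟩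
  | succ k ih =>
    obtain ⟨S, hs, ht, hS⟩ := ih (fun j hj => h j (by omega))
    have hb := h k (by omega)
    by_cases hq : qd A g k (vq A g k)
    · refine ⟨S, hs, ht, fun a b hab => hS a b ⟨hab.1, ?_⟩⟩
      have := hab.2
      rw [qd_succ, qd_succ] at this
      rcases this with (h | h) | (h | h)
      · exact Or.inl h
      · rw [h]; exact Or.inl hq
      · exact Or.inr h
      · rw [h]; exact Or.inr hq
    · set v := vq A g k with hv
      -- fresh neighbours
      let N : Set (Fin n) := {u | ¬ qd A g k u ∧ gAdj g v u}
      have hN : ∀ u ∈ N, u ≠ s ∧ u ≠ t ∧ ∀ w, qd A g k w → ¬ gAdj g w u := by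
        rintro u ⟨hu1, hu2⟩
        refine ⟨fun he => hb ⟨u, ⟨hu1, hq, Or.inl he⟩, hu2⟩,
          fun he => hb ⟨u, ⟨hu1, hq, Or.inr (Or.inl he)⟩, hu2⟩, fun w hw hg =>
          hb ⟨u, ⟨hu1, hq, Or.inr (Or.inr ⟨hu1, w, hw, hg⟩)⟩, hu2⟩⟩
      have hvN : v ∉ N := fun h => gAdj_ne h.2 rfl
      let S' : Set (Fin n) := {u | (u ∈ N ∧ v ∈ S) ∨ (u ∉ N ∧ u ∈ S)}
      have hsN : s ∉ N := fun h => (hN s h).1 rfl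
      have htN : t ∉ N := fun h => (hN t h).2.1 rfl
      have hout : ∀ u, u ∉ N → (u ∈ S' ↔ u ∈ S) := by
        intro u hu
        simp [S', hu]
      have hin : ∀ u, u ∈ N → (u ∈ S' ↔ v ∈ S) := by
        intro u hu
        simp [S', hu]
      have key : ∀ a b, gAdj g a b → (qd A g k a ∨ a = v) → (a ∈ S' ↔ b ∈ S') := by
        intro a b hab ha
        by_cases ha' : qd A g k a
        · have haN : a ∉ N := fun h => h.1 ha'
          have hbN : b ∉ N := fun h => (hN b h).2.2 a ha' hab
          rw [hout a haN, hout b hbN]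
          exact hS a b ⟨hab, Or.inl ha'⟩
        · have hav := ha.resolve_left ha'
          subst hav
          rw [hout _ hvN]
          by_cases hb' : qd A g k b
          · have hbN : b ∉ N := fun h => h.1 hb'
            rw [hout b hbN]
            exact hS _ b ⟨hab, Or.inr hb'⟩
          · rw [hin b ⟨hb', hab⟩]
      refine ⟨S', (hout s hsN).2 hs, fun h => ht ((hout t htN).1 h), ?_⟩
      rintro a b ⟨hab, h | h⟩
      · rw [qd_succ] at h
        exact key a b hab h
      · rw [qd_succ] at h
        exact (key b a (gAdj_symm hab) h).symm

theorem chain_aux {α : Type*} (R D : α → α → Prop) (S : Set α) (hS : ∀ a b, D a b → (a ∈ S ↔ b ∈ S))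
    (L : List α) (s t : α) (hs : L.head? = some s) (ht : L.getLast? = some t)
    (hc : List.IsChain R L) (hsS : s ∈ S) (htS : t ∉ S) :
    ∃ a b, [a, b] <:+: L ∧ R a b ∧ ¬ D a b := by
  induction L generalizing s with
  | nil => simp at hs
  | cons x L ih =>
    simp at hs
    subst hs
    cases L with
    | nil =>
      simp at ht
      subst ht
      exact absurd hsS htS
    | cons y L =>
      rw [List.isChain_cons_cons] at hc
      by_cases hD : D x y
      · obtain ⟨a, b, h1, h2⟩ := ih y (by simp) (by simpa using ht) hc.2 ((hS x y hD).1 hsS)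
        exact ⟨a, b, h1.trans (List.suffix_cons _ _).isInfix, h2⟩
      · exact ⟨x, y, (List.prefix_append [x, y] L).isInfix, hc.1, hD⟩

def cand {n : ℕ} (A : ERAlgo n) (h : List (Fin n × Finset (Fin n))) (c : Fin n × Fin n) : Prop :=
  c.1 ∉ h.map Prod.fst ∧ c.2 ∉ h.map Prod.fst ∧ [c.1, c.2] <:+: A.output h ∧ c.1 ≠ c.2

open Classical in
noncomputable def pick {n : ℕ} (A : ERAlgo n) (h : List (Fin n × Finset (Fin n))) :
    Option (Fin n × Fin n) :=
  if hx : ∃ c, cand A h c then some hx.choose else none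

theorem pick_spec {n : ℕ} (A : ERAlgo n) (h : List (Fin n × Finset (Fin n))) (c : Fin n × Fin n)
    (hc : pick A h = some c) : cand A h c := by
  unfold pick at hc
  split_ifs at hc with hx
  · have := hx.choose_spec
    simp only [Option.some.injEq] at hc
    rwa [hc] at this

theorem pick_ex {n : ℕ} (A : ERAlgo n) (h : List (Fin n × Finset (Fin n))) (c : Fin n × Fin n)
    (hc : cand A h c) : ∃ d, pick A h = some d := by
  unfold pick
  rw [dif_pos ⟨c, hc⟩]
  exact ⟨_, rfl⟩

theorem infix_adj {α : Type*} {R : α → α → Prop} {L : List α} {a b : α} (h : [a, b] <:+: L)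
    (hc : List.IsChain R L) : R a b := by
  have := hc.infix h
  simpa using this

theorem guess_prob {n : ℕ} {p : ℝ} (h0 : 0 ≤ p) (h1 : p ≤ 1) (A : ERAlgo n) (q : ℕ) :
    erProb n p (fun g => ∃ c : Fin n × Fin n, pick A (erRun A g q) = some c ∧ gAdj g c.1 c.2)
      ≤ p := by
  calc _ ≤ ∑ c : Fin n × Fin n, erProb n p
            (fun g => pick A (erRun A g q) = some c ∧ gAdj g c.1 c.2) := by
          apply erProb_union h0 h1
          rintro g ⟨c, h⟩
          exact ⟨c, Finset.mem_univ _, h⟩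
    _ ≤ ∑ c : Fin n × Fin n, p * erProb n p (fun g => pick A (erRun A g q) = some c) := by
          apply Finset.sum_le_sum
          intro c _
          apply fresh_edge h0 h1 A q
          · exact fun g h => (pick_spec A _ c h).1
          · exact fun g h => (pick_spec A _ c h).2.1
          · intro g g' h hr _
            rw [hr]
            exact h
    _ ≤ p * 1 := by
          rw [← Finset.mul_sum]
          apply mul_le_mul_of_nonneg_left _ h0
          refine le_trans (erProb_disj h0 h1 _ (fun _ => True) _ (fun _ _ _ _ => trivial) ?_)
            (erProb_le_one h0 h1 _)
          intro g i _ j _ hi hj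
          simpa using hi.symm.trans hj
    _ = p := mul_one p

theorem final_ineq (n q : ℕ) (hn : 2 ≤ n) (p : ℝ) (h0 : 0 ≤ p) :
    ∑ k ∈ Finset.range q, p * (2 + n * (k * p)) ≤
      p ^ 2 * n * ((q : ℝ) + 1) ^ 2 + q / Real.sqrt n := by
  have hn' : (2 : ℝ) ≤ n := by exact_mod_cast hn
  set r := Real.sqrt n with hr
  have hr1 : 1 ≤ r := by
    rw [hr, Real.one_le_sqrt]
    linarith
  have hrr : r * r = n := Real.mul_self_sqrt (by linarith)
  have h2p : 2 * p ≤ 1 / r + p ^ 2 * n := by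
    have h3 : 2 * p ≤ 1 / r + p ^ 2 * r := by
      have : 1 / r + p ^ 2 * r - 2 * p = (1 - p * r) ^ 2 / r := by
        field_simp
        ring
      have h4 : 0 ≤ (1 - p * r) ^ 2 / r := by positivity
      linarith
    have : p ^ 2 * r ≤ p ^ 2 * n := by
      apply mul_le_mul_of_nonneg_left _ (sq_nonneg p)
      nlinarith
    linarith
  have hpn : 0 ≤ p ^ 2 * n := by positivity
  calc _ ≤ ∑ k ∈ Finset.range q, (1 / r + p ^ 2 * n * (1 + q)) := by
          apply Finset.sum_le_sum
          intro k hk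
          have hk : (k : ℝ) ≤ q := by exact_mod_cast (Finset.mem_range.1 hk).le
          nlinarith [mul_le_mul_of_nonneg_left hk hpn]
    _ = q / r + p ^ 2 * n * (q * (1 + q)) := by
          simp
          ring
    _ ≤ _ := by
          have : (q : ℝ) * (1 + q) ≤ (q + 1) ^ 2 := by
            have : (0 : ℝ) ≤ q := by positivity
            nlinarith
          have := mul_le_mul_of_nonneg_left this hpn
          linarith

end helpers

/-- Let `2 ≤ n`, `1.5·ln(n)/n ≤ p < 1`, and let `G ~ G(n,p)` with `s = 1` (vertex `0` of
`Fin n`) and `t = n` (vertex `n−1`).  Every deterministic adaptive node-incidence query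
algorithm making at most `q` queries outputs a valid `s`-`t` path with probability at most
`p + p²·n·(q+1)² + q/√n`.  (Consequently any, possibly randomized, algorithm making
`o(1/(p√n))` node-incidence queries outputs a valid `s`-`t` path with probability at most
`p + o(1)`.) -/
theorem stmt8 (n q : ℕ) (hn : 2 ≤ n) (p : ℝ)
    (hp1 : 1.5 * Real.log n / n ≤ p) (hp2 : p < 1) (A : ERAlgo n) :
    erProb n p (fun g =>
        IsValidPath g ⟨0, by omega⟩ ⟨n - 1, by omega⟩ (A.output (erRun A g q)))
      ≤ p + p ^ 2 * n * ((q : ℝ) + 1) ^ 2 + q / Real.sqrt n := by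
  have hn' : (2 : ℝ) ≤ n := by exact_mod_cast hn
  have h0 : 0 ≤ p := by
    refine le_trans ?_ hp1
    have := Real.log_nonneg (by linarith : (1 : ℝ) ≤ n)
    positivity
  have h1 : p ≤ 1 := hp2.le
  set s : Fin n := ⟨0, by omega⟩ with hs
  set t : Fin n := ⟨n - 1, by omega⟩ with ht
  have hst : s ≠ t := by
    rw [hs, ht]
    simp
    omega
  have hA := erProb_or h0 h1 (fun g => IsValidPath g s t (A.output (erRun A g q)))
    (fun g => ∃ c : Fin n × Fin n, pick A (erRun A g q) = some c ∧ gAdj g c.1 c.2)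
    (fun g => ∃ k ∈ Finset.range q, bad s t A g k) (by
      rintro g ⟨ha, hb, hc⟩
      by_cases hbad : ∃ k ∈ Finset.range q, bad s t A g k
      · exact Or.inr hbad
      left
      push Not at hbad
      obtain ⟨S, hsS, htS, hS⟩ := no_bad s t hst A g q
        (fun j hj => hbad j (Finset.mem_range.2 hj))
      obtain ⟨a, b, hi, hab, hD⟩ := chain_aux (gAdj g) (dAdj A g q) S hS _ s t ha hb hc hsS htS
      have hD' : ¬ (qd A g q a ∨ qd A g q b) := fun h => hD ⟨hab, h⟩
      push Not at hD'
      obtain ⟨d, hd⟩ := pick_ex A (erRun A g q) (a, b) ⟨hD'.1, hD'.2, hi, gAdj_ne hab⟩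
      exact ⟨d, hd, infix_adj (pick_spec A _ d hd).2.2.1 hc⟩)
  have hB : erProb n p (fun g => ∃ k ∈ Finset.range q, bad s t A g k) ≤
      ∑ k ∈ Finset.range q, p * (2 + n * (k * p)) :=
    (erProb_union h0 h1 (Finset.range q) _ (fun k g => bad s t A g k) (fun g h => h)).trans
      (Finset.sum_le_sum (fun k _ => bad_prob h0 h1 s t A k))
  have hC := guess_prob h0 h1 A q
  have hF := final_ineq n q hn p h0
  linarith
end

section
/- Let G be an Erdős–Rényi random graph G(n,p) on vertex set {1,…,n} with s = 1 and t = n, and fix a deterministic adaptive node-incidence query algorithm making q queries that then outputs a vertex sequence from s to t. Let τ = (i₁,N₁,…,i_q,N_q) be any transcript of queries and answers occurring with positive probability such that s and t are not connected in the subgraph formed by the discovered edges ⋃_j N_j. Then, conditioned on the algorithm producing transcript τ, the probability that the output sequence is a valid s-t path in G is at most p. -/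
theorem aux_chain {α : Type*} (R D : α → α → Prop) (t : α) : ∀ (L : List α) (s : α),
    L.head? = some s → L.getLast? = some t → L.IsChain R → ¬Relation.ReflTransGen D s t →
    ∃ u v, R u v ∧ ¬ D u v ∧ ∀ R' : α → α → Prop, L.IsChain R' → R' u v := by
  intro L
  induction L with
  | nil => intro s h; simp at h
  | cons a l ih =>
    intro s h1 h2 h3 h4
    simp only [List.head?_cons, Option.some.injEq] at h1
    subst h1
    cases l with
    | nil =>
      simp only [List.getLast?_singleton, Option.some.injEq] at h2
      subst h2
      exact absurd Relation.ReflTransGen.refl h4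
    | cons b l =>
      rw [List.isChain_cons_cons] at h3
      by_cases hD : D a b
      · obtain ⟨u, v, h5, h6, h7⟩ := ih b rfl (by simpa using h2) h3.2
          (fun h => h4 (Relation.ReflTransGen.head hD h))
        exact ⟨u, v, h5, h6, fun R' hR => h7 R' (List.isChain_cons_cons.1 hR).2⟩
      · exact ⟨a, b, h3.1, hD, fun R' hR => (List.isChain_cons_cons.1 hR).1⟩

theorem aux_run {n : ℕ} (A : ERAlgo n) (g g' : EdgeSlot n → Bool) : ∀ q : ℕ,
    (∀ x ∈ erRun A g q, nbhd g' x.1 = nbhd g x.1) → erRun A g' q = erRun A g q := by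
  intro q
  induction q with
  | zero => intro _; rfl
  | succ q ih =>
    intro h
    simp only [erRun, List.mem_append, List.mem_singleton] at h ⊢
    have h1 := ih (fun x hx => h x (Or.inl hx))
    rw [h1, h _ (Or.inr rfl)]

theorem aux_mem_s10 {n : ℕ} (A : ERAlgo n) (g : EdgeSlot n → Bool) : ∀ q : ℕ,
    ∀ x ∈ erRun A g q, x.2 = nbhd g x.1 := by
  intro q
  induction q with
  | zero => intro x hx; simp [erRun] at hx
  | succ q ih =>
    intro x hx
    simp only [erRun, List.mem_append, List.mem_singleton] at hx
    rcases hx with hx | hx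
    · exact ih x hx
    · subst hx; rfl

theorem aux_mem_nbhd {n : ℕ} (g : EdgeSlot n → Bool) (u v : Fin n) :
    u ∈ nbhd g v ↔ gAdj g v u := by
  simp [nbhd]

theorem aux_nbhd {n : ℕ} (g g' : EdgeSlot n → Bool) (e : EdgeSlot n)
    (h : ∀ f, f ≠ e → g' f = g f) (w : Fin n) (hw : w ∉ e.1) : nbhd g' w = nbhd g w := by
  ext x
  rw [aux_mem_nbhd, aux_mem_nbhd]
  unfold gAdj
  refine exists_congr fun f => and_congr_right fun hf => ?_
  rw [h f]
  rintro rfl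
  exact hw (hf ▸ Sym2.mem_mk_left w x)

theorem aux_weight {n : ℕ} (p : ℝ) (g g' : EdgeSlot n → Bool) (e : EdgeSlot n)
    (h : ∀ f, f ≠ e → g' f = g f) (h1 : g e = true) (h2 : g' e = false) :
    (1 - p) * erWeight p g = p * erWeight p g' := by
  classical
  unfold erWeight
  rw [← Finset.mul_prod_erase Finset.univ _ (Finset.mem_univ e),
    ← Finset.mul_prod_erase Finset.univ (fun f => if g' f = true then p else 1 - p)
      (Finset.mem_univ e)]
  have : ∏ f ∈ Finset.univ.erase e, (if g' f = true then p else 1 - p)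
      = ∏ f ∈ Finset.univ.erase e, (if g f = true then p else 1 - p) := by
    refine Finset.prod_congr rfl fun f hf => ?_
    rw [h f (Finset.ne_of_mem_erase hf)]
  rw [this, h1, h2]
  simp
  ring

theorem aux_prob {n : ℕ} (p : ℝ) (E : (EdgeSlot n → Bool) → Prop) (e : EdgeSlot n)
    (hE : ∀ g g' : EdgeSlot n → Bool, (∀ f, f ≠ e → g' f = g f) → E g → E g') :
    erProb n p (fun g => E g ∧ g e = true) = p * erProb n p E := by
  classical
  have key : (1 - p) * erProb n p (fun g => E g ∧ g e = true)
      = p * erProb n p (fun g => E g ∧ g e = false) := by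
    unfold erProb
    rw [Finset.mul_sum, Finset.mul_sum]
    let φ : (EdgeSlot n → Bool) → (EdgeSlot n → Bool) := fun g => Function.update g e (!g e)
    have hφ : Function.Involutive φ := by
      intro g
      simp [φ]
    refine Eq.trans ?_ (Equiv.sum_comp hφ.toPerm _)
    refine Finset.sum_congr rfl fun g _ => ?_
    have hd : ∀ f, f ≠ e → φ g f = g f := fun f hf => by simp [φ, hf]
    have he : φ g e = !g e := by simp [φ]
    have hEE : E (φ g) ↔ E g :=
      ⟨hE _ _ (fun f hf => (hd f hf).symm), hE _ _ hd⟩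
    change _ = p * (@ite ℝ (E (φ g) ∧ φ g e = false) (Classical.propDecidable _)
      (erWeight p (φ g)) 0)
    by_cases h : E g ∧ g e = true
    · rw [if_pos h, if_pos (by simpa [hEE, he] using h)]
      exact aux_weight p g (φ g) e hd h.2 (by simp [he, h.2])
    · rw [if_neg h, if_neg (by simpa [hEE, he] using h)]
      simp
  have hsum : erProb n p E = erProb n p (fun g => E g ∧ g e = true)
      + erProb n p (fun g => E g ∧ g e = false) := by
    unfold erProb
    rw [← Finset.sum_add_distrib]
    refine Finset.sum_congr rfl fun g _ => ?_
    by_cases h : E g <;> cases hg : g e <;> simp [h, hg]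
  rw [hsum]
  linarith

theorem aux_mono {n : ℕ} (p : ℝ) (hp0 : 0 ≤ p) (hp1 : p ≤ 1) (E F : (EdgeSlot n → Bool) → Prop)
    (h : ∀ g, E g → F g) : erProb n p E ≤ erProb n p F := by
  classical
  unfold erProb
  refine Finset.sum_le_sum fun g _ => ?_
  have hw : 0 ≤ erWeight p g := Finset.prod_nonneg fun f _ => by split_ifs <;> linarith
  by_cases hE : E g
  · simp [hE, h g hE]
  · simp only [hE, if_false]
    split_ifs <;> simp [hw]

/-- Let `G ~ G(n,p)` with `s = 1` (vertex `0` of `Fin n`) and `t = n` (vertex `n−1`), and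
fix a deterministic adaptive node-incidence query algorithm making `q` queries and then
outputting a vertex sequence.  If `τ` is a transcript occurring with positive probability
in which the discovered edges do not connect `s` and `t`, then, conditioned on the
transcript being `τ`, the output is a valid `s`-`t` path with probability at most `p`
(stated as: `Pr[transcript = τ ∧ output valid] ≤ p · Pr[transcript = τ]`). -/
theorem stmt10 (n q : ℕ) (hn : 2 ≤ n) (p : ℝ) (hp0 : 0 ≤ p) (hp1 : p ≤ 1) (A : ERAlgo n)
    (τ : List (Fin n × Finset (Fin n)))
    (hpos : 0 < erProb n p (fun g => erRun A g q = τ))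
    (hdisc : ¬Relation.ReflTransGen (discAdj τ) ⟨0, by omega⟩ ⟨n - 1, by omega⟩) :
    erProb n p (fun g => erRun A g q = τ ∧
        IsValidPath g ⟨0, by omega⟩ ⟨n - 1, by omega⟩ (A.output τ))
      ≤ p * erProb n p (fun g => erRun A g q = τ) := by
  classical
  by_cases hex : ∃ g, erRun A g q = τ ∧
      IsValidPath g ⟨0, by omega⟩ ⟨n - 1, by omega⟩ (A.output τ)
  · obtain ⟨g, hg, h1, h2, h3⟩ := hex
    obtain ⟨u, v, huv, hD, hall⟩ := aux_chain _ _ _ _ _ h1 h2 h3 hdisc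
    obtain ⟨e, he, hge⟩ := huv
    have hq : ∀ x ∈ τ, x.1 ∉ e.1 := by
      intro x hx hxe
      have hx2 : x.2 = nbhd g x.1 := aux_mem_s10 A g q x (hg ▸ hx)
      rw [he, Sym2.mem_iff] at hxe
      refine hD ⟨x, hx, ?_⟩
      rw [hx2, aux_mem_nbhd, aux_mem_nbhd]
      rcases hxe with h | h
      · exact Or.inl ⟨h, e, by rw [he, h], hge⟩
      · exact Or.inr ⟨h, e, by rw [he, h, Sym2.eq_swap], hge⟩
    rw [← aux_prob p (fun g => erRun A g q = τ) e]
    · refine aux_mono p hp0 hp1 _ _ fun g' hg' => ⟨hg'.1, ?_⟩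
      obtain ⟨f, hf, hgf⟩ := hall _ hg'.2.2.2
      have : f = e := Subtype.ext (hf.trans he.symm)
      rwa [← this]
    · intro g1 g2 h12 hg1
      have := aux_run A g1 g2 q (fun x hx => aux_nbhd g1 g2 e h12 x.1 (hq x (hg1 ▸ hx)))
      exact this.trans hg1
  · have : erProb n p (fun g => erRun A g q = τ ∧
        IsValidPath g ⟨0, by omega⟩ ⟨n - 1, by omega⟩ (A.output τ)) = 0 := by
      unfold erProb
      refine Finset.sum_eq_zero fun g _ => ?_
      rw [if_neg]
      exact fun h => hex ⟨g, h⟩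
    rw [this]
    exact mul_nonneg hp0 hpos.le
end
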